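/- Let d ≥ 1 and r ≥ 1, and suppose (A,W) ∈ T(r,C₀). Then there exists a constant C > 0 such that for every complex-valued u ∈ C_0^∞(ℝ^d), ‖ |W| u ‖² ≤ C ( ‖P_{A,W} u‖² + ‖u‖² ), where |W| = (U² + V²)^{1/2}. -/

import Mathlib

open MeasureTheory Real Filter

noncomputable section

/-- `ℝ^d` with the Euclidean structure. -/
abbrev Rd (d : ℕ) := EuclideanSpace ℝ (Fin d)

/-- Partial derivative `∂_{x_j}` of a complex-valued function. -/
def pdC {d : ℕ} (j : Fin d) (f : Rd d → ℂ) : Rd d → ℂ :=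
  fun x => fderiv ℝ f x (EuclideanSpace.single j (1:ℝ))

/-- Partial derivative `∂_{x_j}` of a real-valued function. -/
def pdR {d : ℕ} (j : Fin d) (f : Rd d → ℝ) : Rd d → ℝ :=
  fun x => fderiv ℝ f x (EuclideanSpace.single j (1:ℝ))

/-- Iterated partial derivative in the `j`-th direction. -/
def pdIter {d : ℕ} (j : Fin d) : ℕ → (Rd d → ℝ) → (Rd d → ℝ)
  | 0, f => f
  | n+1, f => pdR j (pdIter j n f)

/-- Multi-index partial derivative `∂^α`. -/
def pdMulti {d : ℕ} (α : Fin d → ℕ) (f : Rd d → ℝ) : Rd d → ℝ :=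
  (List.finRange d).foldr (fun j g => pdIter j (α j) g) f

/-- The finite set of multi-indices `α` with `|α| = q`. -/
def mIdx (d q : ℕ) : Finset (Fin d → ℕ) := Finset.Nat.antidiagonalTuple d q

/-- The magnetic field `B_{jk} = ∂_j A_k - ∂_k A_j`. -/
def magB {d : ℕ} (A : Fin d → Rd d → ℝ) (j k : Fin d) : Rd d → ℝ :=
  fun x => pdR j (A k) x - pdR k (A j) x

/-- The quantity `m̌_q(x)`. -/
def mq {d p : ℕ} (A : Fin d → Rd d → ℝ) (U : Fin p → Rd d → ℝ) (V : Rd d → ℝ) :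
    ℕ → Rd d → ℝ
  | 0, x => ∑ ℓ, |U ℓ x|
  | q+1, x =>
      (∑ ℓ, ∑ α ∈ mIdx d (q+1), |pdMulti α (U ℓ) x|)
      + (∑ jk ∈ Finset.univ.filter (fun jk : Fin d × Fin d => jk.1 < jk.2),
          ∑ α ∈ mIdx d q, |pdMulti α (magB A jk.1 jk.2) x|)
      + ∑ α ∈ mIdx d q, |pdMulti α V x|

/-- The quantity `m̌ʳ(x) = 1 + ∑_{q=0}^r m̌_q(x)`. -/
def mr {d p : ℕ} (A : Fin d → Rd d → ℝ) (U : Fin p → Rd d → ℝ) (V : Rd d → ℝ)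
    (r : ℕ) (x : Rd d) : ℝ :=
  1 + ∑ q ∈ Finset.range (r+1), mq A U V q x

/-- The magnetic derivative `X_j u = (D_{x_j} - A_j) u`, `D_{x_j} = -i ∂_{x_j}`. -/
def Xop {d : ℕ} (A : Fin d → Rd d → ℝ) (j : Fin d) (u : Rd d → ℂ) : Rd d → ℂ :=
  fun x => -Complex.I * pdC j u x - (A j x : ℂ) * u x

/-- The potential `W = ∑_ℓ U_ℓ² + iV`. -/
def Wfun {d p : ℕ} (U : Fin p → Rd d → ℝ) (V : Rd d → ℝ) (x : Rd d) : ℂ :=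
  ((∑ ℓ, (U ℓ x)^2 : ℝ) : ℂ) + (V x : ℝ) * Complex.I

/-- The operator `P_{A,W} u = ∑_j X_j² u + W u` with `W = ∑_ℓ U_ℓ² + iV`. -/
def Pop {d p : ℕ} (A : Fin d → Rd d → ℝ) (U : Fin p → Rd d → ℝ) (V : Rd d → ℝ)
    (u : Rd d → ℂ) : Rd d → ℂ :=
  fun x => (∑ j, Xop A j (Xop A j u) x) + Wfun U V x * u x

/-- The function `Φ(x,t)`. -/
def Phi {d p : ℕ} (A : Fin d → Rd d → ℝ) (U : Fin p → Rd d → ℝ) (V : Rd d → ℝ)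
    (r : ℕ) (x : Rd d) (t : ℝ) : ℝ :=
  (∑ ℓ, ∑ q ∈ Finset.range (r+1), t^(q+1) * ∑ α ∈ mIdx d q, |pdMulti α (U ℓ) x|)
  + (∑ jk ∈ Finset.univ.filter (fun jk : Fin d × Fin d => jk.1 < jk.2),
      ∑ q ∈ Finset.range r, t^(q+2) * ∑ α ∈ mIdx d q, |pdMulti α (magB A jk.1 jk.2) x|)
  + ∑ q ∈ Finset.range r, t^(q+2) * ∑ α ∈ mIdx d q, |pdMulti α V x|

/-- `R(x,μ) = sup { t ∈ [0,1] : Φ(x,t) ≤ μ }`. -/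
def Rfun {d p : ℕ} (A : Fin d → Rd d → ℝ) (U : Fin p → Rd d → ℝ) (V : Rd d → ℝ)
    (r : ℕ) (x : Rd d) (μ : ℝ) : ℝ :=
  sSup {t : ℝ | t ∈ Set.Icc (0:ℝ) 1 ∧ Phi A U V r x t ≤ μ}



open scoped ContDiff

section pcalc
variable {d : ℕ}

/-- basis vector -/
abbrev ee (j : Fin d) : Rd d := EuclideanSpace.single j (1:ℝ)

lemma line_hasDerivAt {E : Type*} [NormedAddCommGroup E] [NormedSpace ℝ E] {f : Rd d → E} {x : Rd d}
    (hf : DifferentiableAt ℝ f x) (j : Fin d) :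
    HasDerivAt (fun t : ℝ => f (x + t • ee j)) (fderiv ℝ f x (ee j)) 0 :=
  hf.hasFDerivAt.hasLineDerivAt (ee j)

lemma fderiv_eq_of_line {E : Type*} [NormedAddCommGroup E] [NormedSpace ℝ E] {f : Rd d → E} {x : Rd d}
    (hf : DifferentiableAt ℝ f x) {j : Fin d} {c : E}
    (h : HasDerivAt (fun t : ℝ => f (x + t • ee j)) c 0) : fderiv ℝ f x (ee j) = c :=
  (line_hasDerivAt hf j).unique h

lemma pdR_line {f : Rd d → ℝ} (hf : ContDiff ℝ ∞ f) (j : Fin d) (x : Rd d) :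
    HasDerivAt (fun t : ℝ => f (x + t • ee j)) (pdR j f x) 0 :=
  line_hasDerivAt (hf.differentiable (by simp) x) j

lemma pdC_line {f : Rd d → ℂ} (hf : ContDiff ℝ ∞ f) (j : Fin d) (x : Rd d) :
    HasDerivAt (fun t : ℝ => f (x + t • ee j)) (pdC j f x) 0 :=
  line_hasDerivAt (hf.differentiable (by simp) x) j

lemma pdR_eq {f : Rd d → ℝ} (hf : ContDiff ℝ ∞ f) {j : Fin d} {x : Rd d} {c : ℝ}
    (h : HasDerivAt (fun t : ℝ => f (x + t • ee j)) c 0) : pdR j f x = c :=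
  fderiv_eq_of_line (hf.differentiable (by simp) x) h

lemma pdC_eq {f : Rd d → ℂ} (hf : ContDiff ℝ ∞ f) {j : Fin d} {x : Rd d} {c : ℂ}
    (h : HasDerivAt (fun t : ℝ => f (x + t • ee j)) c 0) : pdC j f x = c :=
  fderiv_eq_of_line (hf.differentiable (by simp) x) h

lemma pdR_smooth {f : Rd d → ℝ} (hf : ContDiff ℝ ∞ f) (j : Fin d) : ContDiff ℝ ∞ (pdR j f) :=
  (hf.fderiv_right (m := ∞) (by simp)).clm_apply contDiff_const

lemma pdC_smooth {f : Rd d → ℂ} (hf : ContDiff ℝ ∞ f) (j : Fin d) : ContDiff ℝ ∞ (pdC j f) :=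
  (hf.fderiv_right (m := ∞) (by simp)).clm_apply contDiff_const

lemma snd_symm {E : Type*} [NormedAddCommGroup E] [NormedSpace ℝ E] {f : Rd d → E}
    (hf : ContDiff ℝ ∞ f) (v w x : Rd d) :
    fderiv ℝ (fun y => fderiv ℝ f y v) x w = fderiv ℝ (fun y => fderiv ℝ f y w) x v := by
  have hd : DifferentiableAt ℝ (fderiv ℝ f) x :=
    ((hf.fderiv_right (m := ∞) (by simp)).differentiable (by simp)) x
  have key : ∀ v w : Rd d, fderiv ℝ (fun y => fderiv ℝ f y v) x w = fderiv ℝ (fderiv ℝ f) x w v := by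
    intro v w
    rw [fderiv_clm_apply hd (differentiableAt_const v)]
    simp
  rw [key, key]
  have := (hf.contDiffAt (x := x)).isSymmSndFDerivAt (by
    rw [minSmoothness_of_isRCLikeNormedField]
    exact WithTop.coe_le_coe.2 (le_top : (2:ℕ∞) ≤ ⊤))
  exact this w v

lemma pdR_comm {f : Rd d → ℝ} (hf : ContDiff ℝ ∞ f) (j k : Fin d) :
    pdR j (pdR k f) = pdR k (pdR j f) := by
  funext x; exact snd_symm hf _ _ x

lemma pdC_comm {f : Rd d → ℂ} (hf : ContDiff ℝ ∞ f) (j k : Fin d) :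
    pdC j (pdC k f) = pdC k (pdC j f) := by
  funext x; exact snd_symm hf _ _ x

lemma pdIter_smooth (j : Fin d) (n : ℕ) {f : Rd d → ℝ} (hf : ContDiff ℝ ∞ f) :
    ContDiff ℝ ∞ (pdIter j n f) := by
  induction n with
  | zero => exact hf
  | succ n ih => exact pdR_smooth ih j

lemma pdIter_comm (j k : Fin d) (n : ℕ) {f : Rd d → ℝ} (hf : ContDiff ℝ ∞ f) :
    pdR k (pdIter j n f) = pdIter j n (pdR k f) := by
  induction n with
  | zero => rfl
  | succ n ih =>
    show pdR k (pdR j (pdIter j n f)) = pdR j (pdIter j n (pdR k f))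
    rw [pdR_comm (pdIter_smooth j n hf), ih]

lemma foldr_smooth (α : Fin d → ℕ) (l : List (Fin d)) {f : Rd d → ℝ} (hf : ContDiff ℝ ∞ f) :
    ContDiff ℝ ∞ (l.foldr (fun j g => pdIter j (α j) g) f) := by
  induction l with
  | nil => exact hf
  | cons a l ih => exact pdIter_smooth a _ ih

lemma pdMulti_smooth (α : Fin d → ℕ) {f : Rd d → ℝ} (hf : ContDiff ℝ ∞ f) :
    ContDiff ℝ ∞ (pdMulti α f) := foldr_smooth α _ hf

lemma foldr_notMem (α : Fin d → ℕ) (k : Fin d) (l : List (Fin d)) (hk : k ∉ l) (f : Rd d → ℝ) :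
    l.foldr (fun j g => pdIter j ((α + Pi.single k 1 : Fin d → ℕ) j) g) f
      = l.foldr (fun j g => pdIter j (α j) g) f := by
  induction l with
  | nil => rfl
  | cons a l ih =>
    simp only [List.mem_cons, not_or] at hk
    simp only [List.foldr_cons]
    rw [ih hk.2]
    congr 1
    simp [Pi.single_eq_of_ne (Ne.symm hk.1)]

lemma foldr_mem (α : Fin d → ℕ) (k : Fin d) (l : List (Fin d)) (hn : l.Nodup) (hk : k ∈ l)
    {f : Rd d → ℝ} (hf : ContDiff ℝ ∞ f) :
    l.foldr (fun j g => pdIter j ((α + Pi.single k 1 : Fin d → ℕ) j) g) f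
      = pdR k (l.foldr (fun j g => pdIter j (α j) g) f) := by
  induction l with
  | nil => simp at hk
  | cons a l ih =>
    rw [List.nodup_cons] at hn
    simp only [List.foldr_cons]
    by_cases h : a = k
    · subst h
      rw [foldr_notMem α a l hn.1]
      simp [pdIter]
    · have hk' : k ∈ l := by
        rcases List.mem_cons.1 hk with h' | h'
        · exact absurd h'.symm h
        · exact h'
      rw [ih hn.2 hk', pdIter_comm _ _ _ (foldr_smooth α l hf)]
      simp [Pi.single_eq_of_ne h]

lemma pdMulti_succ (α : Fin d → ℕ) (k : Fin d) {f : Rd d → ℝ} (hf : ContDiff ℝ ∞ f) :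
    pdR k (pdMulti α f) = pdMulti (α + Pi.single k 1) f :=
  (foldr_mem α k _ (List.nodup_finRange d) (List.mem_finRange k) hf).symm

lemma pdMulti_zero (f : Rd d → ℝ) : pdMulti (0 : Fin d → ℕ) f = f := by
  unfold pdMulti
  induction (List.finRange d) with
  | nil => rfl
  | cons a l ih => simp only [List.foldr_cons, ih]; rfl

lemma mem_mIdx {q : ℕ} {α : Fin d → ℕ} : α ∈ mIdx d q ↔ ∑ j, α j = q := by
  simp [mIdx, Finset.Nat.mem_antidiagonalTuple]

lemma integral_fderiv_zero {E : Type*} [NormedAddCommGroup E] [NormedSpace ℝ E] [CompleteSpace E]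
    {f : Rd d → E} (hf : ContDiff ℝ ∞ f)
    (hc : HasCompactSupport f) (v : Rd d) : ∫ x, fderiv ℝ f x v = 0 := by
  have hcont : Continuous (fun x => fderiv ℝ f x v) :=
    ((hf.fderiv_right (m := ∞) (by simp)).clm_apply contDiff_const).continuous
  have h1 : Integrable (fun x => fderiv ℝ f x v) :=
    hcont.integrable_of_hasCompactSupport (hc.fderiv_apply ℝ v)
  have h2 : Integrable f := hf.continuous.integrable_of_hasCompactSupport hc
  have := integral_smul_fderiv_eq_neg_fderiv_smul_of_integrable (μ := volume) (𝕜 := ℝ)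
    (f := fun _ : Rd d => (1:ℝ)) (g := f) (v := v) (by simp) (by simpa using h1) (by simpa using h2)
    (fun x _ => differentiableAt_const _) (fun x _ => hf.differentiable (by simp) x)
  simpa using this

end pcalc

section magnetic
variable {d p : ℕ}

lemma hasDerivAt_ofReal_line {f : Rd d → ℝ} (hf : ContDiff ℝ ∞ f) (j : Fin d) (x : Rd d) :
    HasDerivAt (fun t : ℝ => ((f (x + t • ee j) : ℝ) : ℂ)) ((pdR j f x : ℝ) : ℂ) 0 :=
  (pdR_line hf j x).ofReal_comp

lemma contDiff_ofReal {f : Rd d → ℝ} (hf : ContDiff ℝ ∞ f) :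
    ContDiff ℝ ∞ (fun x => (f x : ℂ)) := Complex.ofRealCLM.contDiff.comp hf

lemma contDiff_conj {f : Rd d → ℂ} (hf : ContDiff ℝ ∞ f) :
    ContDiff ℝ ∞ (fun x => (starRingEnd ℂ) (f x)) := Complex.conjCLE.contDiff.comp hf

lemma Xop_smooth {A : Fin d → Rd d → ℝ} (hA : ∀ j, ContDiff ℝ ∞ (A j)) (j : Fin d)
    {u : Rd d → ℂ} (hu : ContDiff ℝ ∞ u) : ContDiff ℝ ∞ (Xop A j u) :=
  (contDiff_const.mul (pdC_smooth hu j)).sub ((contDiff_ofReal (hA j)).mul hu)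

lemma zero_of_notMem {u : Rd d → ℂ} {x : Rd d} (h : x ∉ tsupport u) : u x = 0 :=
  image_eq_zero_of_notMem_tsupport h

lemma pdC_zero_of_notMem (j : Fin d) {u : Rd d → ℂ} {x : Rd d} (h : x ∉ tsupport u) :
    pdC j u x = 0 := by
  unfold pdC; rw [fderiv_of_notMem_tsupport ℝ h]; simp

lemma Xop_zero_of_notMem (A : Fin d → Rd d → ℝ) (j : Fin d) {u : Rd d → ℂ} {x : Rd d}
    (h : x ∉ tsupport u) : Xop A j u x = 0 := by
  simp [Xop, pdC_zero_of_notMem j h, zero_of_notMem h]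

lemma tsupport_Xop (A : Fin d → Rd d → ℝ) (j : Fin d) (u : Rd d → ℂ) :
    tsupport (Xop A j u) ⊆ tsupport u := by
  apply closure_minimal _ (isClosed_tsupport u)
  intro x hx
  by_contra h
  exact hx (Xop_zero_of_notMem A j h)

lemma Pop_zero_of_notMem (A : Fin d → Rd d → ℝ) (U : Fin p → Rd d → ℝ) (V : Rd d → ℝ)
    {u : Rd d → ℂ} {x : Rd d} (h : x ∉ tsupport u) : Pop A U V u x = 0 := by
  have : ∀ j, Xop A j (Xop A j u) x = 0 := fun j =>
    Xop_zero_of_notMem A j (fun h' => h (tsupport_Xop A j u h'))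
  simp [Pop, this, zero_of_notMem h]

lemma Pop_continuous {A : Fin d → Rd d → ℝ} {U : Fin p → Rd d → ℝ} {V : Rd d → ℝ}
    (hA : ∀ j, ContDiff ℝ ∞ (A j)) (hU : ∀ l, ContDiff ℝ ∞ (U l)) (hV : ContDiff ℝ ∞ V)
    {u : Rd d → ℂ} (hu : ContDiff ℝ ∞ u) : Continuous (Pop A U V u) := by
  have h1 : ∀ j, Continuous (Xop A j (Xop A j u)) := fun j =>
    (Xop_smooth hA j (Xop_smooth hA j hu)).continuous
  have h2 : ∀ l, Continuous (U l) := fun l => (hU l).continuous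
  have h3 := hV.continuous
  have h4 := hu.continuous
  unfold Pop Wfun
  fun_prop

lemma integrable_of_zero {E : Type*} [NormedAddCommGroup E] {u : Rd d → ℂ} (hc : HasCompactSupport u)
    {f : Rd d → E} (hf : Continuous f) (h : ∀ x, x ∉ tsupport u → f x = 0) : Integrable f :=
  hf.integrable_of_hasCompactSupport (HasCompactSupport.intro hc h)

lemma int_le {a b D : Rd d → ℝ} (ha : Integrable a) (hb : Integrable b) (hD : Integrable D)
    (hD0 : ∫ x, D x = 0) (h : ∀ x, a x ≤ b x + D x) : ∫ x, a x ≤ ∫ x, b x := by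
  have h1 : ∫ x, a x ≤ ∫ x, (b x + D x) := integral_mono ha (hb.add hD) h
  rwa [integral_add hb hD, hD0, add_zero] at h1

/-- derivative of `w * conj z` -/
lemma pdC_mul_conj (A : Fin d → Rd d → ℝ) (j : Fin d) {w z : Rd d → ℂ}
    (hw : ContDiff ℝ ∞ w) (hz : ContDiff ℝ ∞ z) (x : Rd d) :
    pdC j (fun x => w x * (starRingEnd ℂ) (z x)) x
      = Complex.I * (Xop A j w x * (starRingEnd ℂ) (z x) - w x * (starRingEnd ℂ) (Xop A j z x)) := by
  have h := pdC_eq (hw.mul (contDiff_conj hz)) (j := j) (x := x)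
    ((pdC_line hw j x).mul ((pdC_line hz j x).star))
  refine h.trans ?_
  simp only [zero_smul, add_zero, Xop, map_sub, map_mul, map_neg, Complex.conj_I, Complex.conj_ofReal]
  simp only [← starRingEnd_apply]
  linear_combination (pdC j w x * (starRingEnd ℂ) (z x) + w x * (starRingEnd ℂ) (pdC j z x)) * Complex.I_sq

lemma Xop_mul (A : Fin d → Rd d → ℝ) (j : Fin d) {φ : Rd d → ℝ} {u : Rd d → ℂ}
    (hφ : ContDiff ℝ ∞ φ) (hu : ContDiff ℝ ∞ u) (x : Rd d) :
    Xop A j (fun x => (φ x : ℂ) * u x) x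
      = φ x * Xop A j u x - Complex.I * pdR j φ x * u x := by
  have h := pdC_eq ((contDiff_ofReal hφ).mul hu) (j := j) (x := x)
    ((hasDerivAt_ofReal_line hφ j x).mul (pdC_line hu j x))
  simp only [Xop]
  rw [h]
  simp only [zero_smul, add_zero]
  ring

/-- the flux function -/
def Gf (A : Fin d → Rd d → ℝ) (k : Fin d) (φ : Rd d → ℝ) (u : Rd d → ℂ) : Rd d → ℂ :=
  fun x => Xop A k u x * (starRingEnd ℂ) ((φ x : ℂ) * u x)

variable {A : Fin d → Rd d → ℝ} {U : Fin p → Rd d → ℝ} {V : Rd d → ℝ}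

lemma Gf_smooth (hA : ∀ j, ContDiff ℝ ∞ (A j)) (k : Fin d) {φ : Rd d → ℝ} {u : Rd d → ℂ}
    (hφ : ContDiff ℝ ∞ φ) (hu : ContDiff ℝ ∞ u) : ContDiff ℝ ∞ (Gf A k φ u) :=
  (Xop_smooth hA k hu).mul (contDiff_conj ((contDiff_ofReal hφ).mul hu))

lemma Gf_compact (k : Fin d) {φ : Rd d → ℝ} {u : Rd d → ℂ}
    (hc : HasCompactSupport u) : HasCompactSupport (Gf A k φ u) :=
  HasCompactSupport.intro hc (fun x hx => by simp [Gf, zero_of_notMem hx])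

lemma Gf_int (hA : ∀ j, ContDiff ℝ ∞ (A j)) (j k : Fin d) {φ : Rd d → ℝ} {u : Rd d → ℂ}
    (hφ : ContDiff ℝ ∞ φ) (hu : ContDiff ℝ ∞ u) (hc : HasCompactSupport u) :
    ∫ x, pdC j (Gf A k φ u) x = 0 :=
  integral_fderiv_zero (Gf_smooth hA k hφ hu) (Gf_compact k hc) _

lemma Gf_integrable (hA : ∀ j, ContDiff ℝ ∞ (A j)) (j k : Fin d) {φ : Rd d → ℝ} {u : Rd d → ℂ}
    (hφ : ContDiff ℝ ∞ φ) (hu : ContDiff ℝ ∞ u) (hc : HasCompactSupport u) :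
    Integrable (pdC j (Gf A k φ u)) :=
  (pdC_smooth (Gf_smooth hA k hφ hu) j).continuous.integrable_of_hasCompactSupport
    ((Gf_compact k hc).fderiv_apply ℝ _)

lemma XX_identity (hA : ∀ j, ContDiff ℝ ∞ (A j)) (j k : Fin d) {φ : Rd d → ℝ} {u : Rd d → ℂ}
    (hφ : ContDiff ℝ ∞ φ) (hu : ContDiff ℝ ∞ u) (x : Rd d) :
    Xop A j (Xop A k u) x * (φ x * (starRingEnd ℂ) (u x))
      = Xop A k u x * (φ x * (starRingEnd ℂ) (Xop A j u x)
          + Complex.I * pdR j φ x * (starRingEnd ℂ) (u x))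
        - Complex.I * pdC j (Gf A k φ u) x := by
  unfold Gf
  rw [pdC_mul_conj A j (Xop_smooth hA k hu) ((contDiff_ofReal hφ).mul hu), Xop_mul A j hφ hu]
  simp only [map_sub, map_mul, Complex.conj_I, Complex.conj_ofReal]
  linear_combination (Xop A j (Xop A k u) x * (φ x * (starRingEnd ℂ) (u x)) - Xop A k u x * (φ x * (starRingEnd ℂ) (Xop A j u x)
          + Complex.I * pdR j φ x * (starRingEnd ℂ) (u x))) * Complex.I_sq

lemma Xop_commutator (hA : ∀ j, ContDiff ℝ ∞ (A j)) (j k : Fin d) {u : Rd d → ℂ}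
    (hu : ContDiff ℝ ∞ u) (x : Rd d) :
    Xop A j (Xop A k u) x - Xop A k (Xop A j u) x = Complex.I * magB A j k x * u x := by
  have h : ∀ j k : Fin d, pdC j (Xop A k u) x
      = -Complex.I * pdC j (pdC k u) x - (pdR j (A k) x * u x + A k x * pdC j u x) := by
    intro j k
    have := pdC_eq (Xop_smooth hA k hu) (j := j) (x := x)
      (((pdC_line (pdC_smooth hu k) j x).const_mul (-Complex.I)).sub
        ((hasDerivAt_ofReal_line (hA k) j x).mul (pdC_line hu j x)))
    simpa using this
  have e : ∀ j k : Fin d, Xop A j (Xop A k u) x = -Complex.I * pdC j (Xop A k u) x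
      - A j x * (-Complex.I * pdC k u x - A k x * u x) := fun j k => rfl
  rw [e, e, h, h, pdC_comm hu j k]
  simp only [magB]
  push_cast
  ring

lemma normSq_pd (A : Fin d → Rd d → ℝ) (j : Fin d) {u : Rd d → ℂ}
    (hu : ContDiff ℝ ∞ u) (x : Rd d) :
    |pdR j (fun x => ‖u x‖^2) x| ≤ 2 * (‖u x‖ * ‖Xop A j u x‖) := by
  have h1 := pdC_mul_conj A j hu hu x
  have hs : ContDiff ℝ ∞ (fun x => ‖u x‖^2) := hu.norm_sq ℝ
  have h2 : pdC j (fun x => u x * (starRingEnd ℂ) (u x)) x = (pdR j (fun x => ‖u x‖^2) x : ℝ) := by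
    have : (fun x => u x * (starRingEnd ℂ) (u x)) = fun x => ((‖u x‖^2 : ℝ) : ℂ) := by
      funext x; rw [Complex.mul_conj']; push_cast; rfl
    rw [this]
    exact pdC_eq (contDiff_ofReal hs) (hasDerivAt_ofReal_line hs j x)
  rw [h2] at h1
  have h3 := congrArg norm h1
  rw [Complex.norm_real, Real.norm_eq_abs] at h3
  rw [h3, norm_mul, Complex.norm_I, one_mul]
  refine (norm_sub_le _ _).trans (le_of_eq ?_)
  simp only [norm_mul, RCLike.norm_conj]
  ring

end magnetic

section estimates
variable {d p : ℕ} {A : Fin d → Rd d → ℝ} {U : Fin p → Rd d → ℝ} {V : Rd d → ℝ}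

/-- energy density -/
def eden (A : Fin d → Rd d → ℝ) (U : Fin p → Rd d → ℝ) (V : Rd d → ℝ) (ρ : Rd d → ℝ)
    (u : Rd d → ℂ) (x : Rd d) : ℝ :=
  ρ x ^ 4 * ‖u x‖^2 + ρ x ^ 2 * ∑ j, ‖Xop A j u x‖^2 + ‖Pop A U V u x‖^2

/-- energy -/
def EE (A : Fin d → Rd d → ℝ) (U : Fin p → Rd d → ℝ) (V : Rd d → ℝ) (ρ : Rd d → ℝ)
    (u : Rd d → ℂ) : ℝ := ∫ x, eden A U V ρ u x

lemma eden_nonneg (ρ : Rd d → ℝ) (u : Rd d → ℂ) (x : Rd d) : 0 ≤ eden A U V ρ u x := by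
  unfold eden; positivity

lemma EE_nonneg (ρ : Rd d → ℝ) (u : Rd d → ℂ) : 0 ≤ EE A U V ρ u :=
  integral_nonneg (eden_nonneg ρ u)

/-- the test function package -/
structure Test (u : Rd d → ℂ) : Prop where
  smooth : ContDiff ℝ ∞ u
  comp : HasCompactSupport u

/-- smooth data package -/
structure Smooths (A : Fin d → Rd d → ℝ) (U : Fin p → Rd d → ℝ) (V : Rd d → ℝ) : Prop where
  hA : ∀ j, ContDiff ℝ ∞ (A j)
  hU : ∀ l, ContDiff ℝ ∞ (U l)
  hV : ContDiff ℝ ∞ V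

lemma int_mul_u {u : Rd d → ℂ} (hu : Test u) {f : Rd d → ℝ} (hf : Continuous f) :
    Integrable (fun x => f x * ‖u x‖^2) :=
  integrable_of_zero hu.comp (hf.mul (hu.smooth.continuous.norm.pow 2))
    (fun x hx => by simp [zero_of_notMem hx])

lemma int_mul_X (hS : Smooths A U V) {u : Rd d → ℂ} (hu : Test u) {f : Rd d → ℝ} (hf : Continuous f)  :
    Integrable (fun x => f x * ∑ j, ‖Xop A j u x‖^2) := by
  have : ∀ j, Continuous (Xop A j u) := fun j => (Xop_smooth hS.hA j hu.smooth).continuous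
  exact integrable_of_zero hu.comp (by fun_prop)
    (fun x hx => by simp [Xop_zero_of_notMem A _ hx])

lemma int_P (hS : Smooths A U V) {u : Rd d → ℂ} (hu : Test u) :
    Integrable (fun x => ‖Pop A U V u x‖^2) :=
  integrable_of_zero hu.comp ((Pop_continuous hS.hA hS.hU hS.hV hu.smooth).norm.pow 2)
    (fun x hx => by simp [Pop_zero_of_notMem A U V hx])

lemma int_eden (hS : Smooths A U V) {u : Rd d → ℂ} (hu : Test u) {ρ : Rd d → ℝ}
    (hρ : ContDiff ℝ ∞ ρ) : Integrable (eden A U V ρ u) :=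
  ((int_mul_u hu (hρ.continuous.pow 4)).add (int_mul_X hS hu (hρ.continuous.pow 2))).add
    (int_P hS hu)

/-- the basic complex identity -/
lemma P_identity (hS : Smooths A U V) {u : Rd d → ℂ} (hu : Test u) {φ : Rd d → ℝ}
    (hφ : ContDiff ℝ ∞ φ) (x : Rd d) :
    Pop A U V u x * (φ x * (starRingEnd ℂ) (u x))
      = ((φ x * ∑ j, ‖Xop A j u x‖^2 : ℝ) : ℂ)
        + ∑ j, Complex.I * pdR j φ x * (Xop A j u x * (starRingEnd ℂ) (u x))
        + Wfun U V x * ((φ x * ‖u x‖^2 : ℝ) : ℂ)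
        - Complex.I * ∑ j, pdC j (Gf A j φ u) x := by
  unfold Pop
  rw [add_mul, Finset.sum_mul, Finset.sum_congr rfl (fun j _ => XX_identity hS.hA j j hφ hu.smooth x)]
  rw [Finset.sum_sub_distrib, ← Finset.mul_sum]
  have h1 : Wfun U V x * u x * (φ x * (starRingEnd ℂ) (u x))
      = Wfun U V x * ((φ x * ‖u x‖^2 : ℝ) : ℂ) := by
    push_cast
    rw [← Complex.mul_conj' (u x)]
    ring
  have h2 : ∑ j, Xop A j u x * (φ x * (starRingEnd ℂ) (Xop A j u x)
          + Complex.I * pdR j φ x * (starRingEnd ℂ) (u x))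
      = ((φ x * ∑ j, ‖Xop A j u x‖^2 : ℝ) : ℂ)
        + ∑ j, Complex.I * pdR j φ x * (Xop A j u x * (starRingEnd ℂ) (u x)) := by
    push_cast
    rw [Finset.mul_sum, ← Finset.sum_add_distrib]
    refine Finset.sum_congr rfl (fun j _ => ?_)
    rw [← Complex.mul_conj' (Xop A j u x)]
    ring
  rw [h1, h2]
  ring

lemma re_int {f : Rd d → ℂ} (hf : Integrable f) (h0 : ∫ x, f x = 0) :
    Integrable (fun x => (f x).re) ∧ ∫ x, (f x).re = 0 := by
  refine ⟨hf.re, ?_⟩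
  have := integral_re (𝕜 := ℂ) hf
  rw [h0] at this
  simpa using this

lemma im_int {f : Rd d → ℂ} (hf : Integrable f) (h0 : ∫ x, f x = 0) :
    Integrable (fun x => (f x).im) ∧ ∫ x, (f x).im = 0 := by
  refine ⟨hf.im, ?_⟩
  have := integral_im (𝕜 := ℂ) hf
  rw [h0] at this
  simpa using this

lemma div_int (hS : Smooths A U V) {u : Rd d → ℂ} (hu : Test u) {φ : Rd d → ℝ}
    (hφ : ContDiff ℝ ∞ φ) :
    Integrable (fun x => Complex.I * ∑ j, pdC j (Gf A j φ u) x) ∧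
    ∫ x, Complex.I * ∑ j, pdC j (Gf A j φ u) x = 0 := by
  have h := fun j => Gf_integrable hS.hA j j hφ hu.smooth hu.comp
  refine ⟨(integrable_finsetSum _ (fun j _ => h j)).const_mul _, ?_⟩
  rw [integral_const_mul, integral_finsetSum _ (fun j _ => h j)]
  simp [Gf_int hS.hA _ _ hφ hu.smooth hu.comp]

lemma P_ineq_re (hS : Smooths A U V) {u : Rd d → ℂ} (hu : Test u) {φ : Rd d → ℝ}
    (hφ : ContDiff ℝ ∞ φ) (x : Rd d) :
    φ x * ∑ j, ‖Xop A j u x‖^2 + (∑ l, U l x ^2) * (φ x * ‖u x‖^2)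
      ≤ ‖Pop A U V u x‖ * (|φ x| * ‖u x‖) + ∑ j, |pdR j φ x| * (‖Xop A j u x‖ * ‖u x‖)
        + (Complex.I * ∑ j, pdC j (Gf A j φ u) x).re := by
  have h := congrArg Complex.re (P_identity hS hu hφ x)
  rw [Complex.sub_re, Complex.add_re, Complex.add_re, Complex.ofReal_re, Complex.re_mul_ofReal] at h
  have hW : (Wfun U V x).re = ∑ l, U l x ^2 := by simp [Wfun, -Complex.ofReal_sum, -Complex.ofReal_pow]
  rw [hW] at h
  have h1 : (Pop A U V u x * (φ x * (starRingEnd ℂ) (u x))).re ≤ ‖Pop A U V u x‖ * (|φ x| * ‖u x‖) := by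
    refine (Complex.re_le_norm _).trans (le_of_eq ?_)
    simp
  have h2 : -(∑ j, Complex.I * pdR j φ x * (Xop A j u x * (starRingEnd ℂ) (u x))).re
      ≤ ∑ j, |pdR j φ x| * (‖Xop A j u x‖ * ‖u x‖) := by
    refine (neg_le_abs _).trans ((Complex.abs_re_le_norm _).trans ((norm_sum_le _ _).trans (le_of_eq ?_)))
    simp
  linarith

lemma P_ineq_im (hS : Smooths A U V) {u : Rd d → ℂ} (hu : Test u) {φ : Rd d → ℝ}
    (hφ : ContDiff ℝ ∞ φ) (x : Rd d) :
    V x * (φ x * ‖u x‖^2)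
      ≤ ‖Pop A U V u x‖ * (|φ x| * ‖u x‖) + ∑ j, |pdR j φ x| * (‖Xop A j u x‖ * ‖u x‖)
        + (Complex.I * ∑ j, pdC j (Gf A j φ u) x).im := by
  have h := congrArg Complex.im (P_identity hS hu hφ x)
  rw [Complex.sub_im, Complex.add_im, Complex.add_im, Complex.ofReal_im, Complex.im_mul_ofReal] at h
  have hW : (Wfun U V x).im = V x := by simp [Wfun, -Complex.ofReal_sum, -Complex.ofReal_pow]
  rw [hW] at h
  have h1 : (Pop A U V u x * (φ x * (starRingEnd ℂ) (u x))).im ≤ ‖Pop A U V u x‖ * (|φ x| * ‖u x‖) := by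
    refine (Complex.im_le_norm _).trans (le_of_eq ?_)
    simp
  have h2 : -(∑ j, Complex.I * pdR j φ x * (Xop A j u x * (starRingEnd ℂ) (u x))).im
      ≤ ∑ j, |pdR j φ x| * (‖Xop A j u x‖ * ‖u x‖) := by
    refine (neg_le_abs _).trans ((Complex.abs_im_le_norm _).trans ((norm_sum_le _ _).trans (le_of_eq ?_)))
    simp
  linarith

lemma energy (hS : Smooths A U V) {u : Rd d → ℂ} (hu : Test u) {ρ : Rd d → ℝ}
    (hρ : ContDiff ℝ ∞ ρ) (h1 : ∀ x, 1 ≤ ρ x) {M : ℝ} 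
    (hM : ∀ j x, |pdR j ρ x| ≤ M * ρ x ^ 2) :
    ∫ x, (ρ x ^ 2 * ∑ j, ‖Xop A j u x‖^2 + (ρ x ^2 * ∑ l, U l x ^2) * ‖u x‖^2)
      ≤ ∫ x, (‖Pop A U V u x‖^2 + ((1 + 4 * d * M^2) * ρ x ^ 4) * ‖u x‖^2) := by
  have hUc : ∀ l, Continuous (U l) := fun l => (hS.hU l).continuous
  have hρc := hρ.continuous
  obtain ⟨hD1, hD2⟩ := div_int hS hu (hρ.pow 2)
  obtain ⟨hr1, hr2⟩ := re_int hD1 hD2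
  refine int_le ((int_mul_X hS hu (hρc.pow 2)).add (int_mul_u hu (by fun_prop)))
    ((int_P hS hu).add (int_mul_u hu (by fun_prop))) (hr1.const_mul 2)
    (by rw [integral_const_mul, hr2, mul_zero]) (fun x => ?_)
  have key := P_ineq_re hS hu (hρ.pow 2) x
  have hρ0 : 0 < ρ x := lt_of_lt_of_le one_pos (h1 x)
  have hpd : ∀ j, |pdR j (fun x => ρ x ^ 2) x| ≤ 2 * M * ρ x ^ 3 := by
    intro j
    have := pdR_eq (hρ.pow 2) (j := j) (x := x) ((pdR_line hρ j x).pow 2)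
    rw [this]
    simp only [zero_smul, add_zero]
    rw [abs_mul, abs_mul]
    simp only [Nat.cast_ofNat, Nat.abs_ofNat, Nat.add_one_sub_one, pow_one, abs_of_pos hρ0]
    calc 2 * ρ x * |pdR j ρ x| ≤ 2 * ρ x * (M * ρ x ^ 2) := by gcongr; exact hM j x
      _ = _ := by ring
  have hsum : ∑ j, |pdR j (fun x => ρ x ^ 2) x| * (‖Xop A j u x‖ * ‖u x‖)
      ≤ ρ x ^ 2 / 2 * ∑ j, ‖Xop A j u x‖^2 + d * (2 * M^2 * ρ x ^ 4 * ‖u x‖^2) := by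
    have : ∀ j ∈ Finset.univ, |pdR j (fun x => ρ x ^ 2) x| * (‖Xop A j u x‖ * ‖u x‖)
        ≤ ρ x ^ 2 / 2 * ‖Xop A j u x‖^2 + 2 * M^2 * ρ x ^ 4 * ‖u x‖^2 := by
      intro j _
      have := mul_le_mul_of_nonneg_right (hpd j) (by positivity : 0 ≤ ‖Xop A j u x‖ * ‖u x‖)
      nlinarith [sq_nonneg (ρ x * ‖Xop A j u x‖ - 2 * M * ρ x ^ 2 * ‖u x‖)]
    refine (Finset.sum_le_sum this).trans (le_of_eq ?_)
    rw [Finset.sum_add_distrib, ← Finset.mul_sum]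
    simp
  rw [abs_of_nonneg (by positivity : 0 ≤ ρ x ^ 2)] at key
  have hUn : 0 ≤ (∑ l, U l x ^ 2) * (ρ x ^ 2 * ‖u x‖ ^ 2) :=
    mul_nonneg (Finset.sum_nonneg (fun l _ => sq_nonneg _)) (by positivity)
  nlinarith [sq_nonneg (‖Pop A U V u x‖ - ρ x ^2 * ‖u x‖)]

lemma V_est (hS : Smooths A U V) {u : Rd d → ℂ} (hu : Test u) {ρ : Rd d → ℝ}
    (hρ : ContDiff ℝ ∞ ρ) (h1 : ∀ x, 1 ≤ ρ x) {M μ : ℝ} (hM0 : 0 ≤ M) (hμ : 0 ≤ μ)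
    (hM : ∀ j x, |pdR j V x| ≤ M * μ * ρ x ^ 3) :
    ∫ x, (V x ^ 2 * ‖u x‖^2) ≤ (1 + M * μ * (1 + d)) * EE A U V ρ u := by
  have hVc := hS.hV.continuous
  obtain ⟨hD1, hD2⟩ := div_int hS hu hS.hV
  obtain ⟨hr1, hr2⟩ := im_int hD1 hD2
  unfold EE
  rw [← integral_const_mul]
  refine int_le (int_mul_u hu (by fun_prop)) ((int_eden hS hu hρ).const_mul _) (hr1.const_mul 2)
    (by rw [integral_const_mul, hr2, mul_zero]) (fun x => ?_)
  have key := P_ineq_im hS hu hS.hV x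
  have hρ0 : 0 < ρ x := lt_of_lt_of_le one_pos (h1 x)
  have hsum : ∑ j, |pdR j V x| * (‖Xop A j u x‖ * ‖u x‖)
      ≤ M * μ / 2 * (ρ x ^ 2 * ∑ j, ‖Xop A j u x‖^2 + d * (ρ x ^ 4 * ‖u x‖^2)) := by
    have : ∀ j ∈ Finset.univ, |pdR j V x| * (‖Xop A j u x‖ * ‖u x‖)
        ≤ M * μ / 2 * ρ x ^ 2 * ‖Xop A j u x‖^2 + M * μ / 2 * (ρ x ^ 4 * ‖u x‖^2) := by
      intro j _
      have := mul_le_mul_of_nonneg_right (hM j x) (by positivity : 0 ≤ ‖Xop A j u x‖ * ‖u x‖)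
      have h2 := mul_nonneg (mul_nonneg hM0 hμ) (sq_nonneg (ρ x * ‖Xop A j u x‖ - ρ x ^ 2 * ‖u x‖))
      nlinarith
    refine (Finset.sum_le_sum this).trans (le_of_eq ?_)
    rw [Finset.sum_add_distrib, ← Finset.mul_sum]
    simp
    ring
  have hVV : V x * (V x * ‖u x‖^2) = (|V x| * ‖u x‖)^2 := by rw [mul_pow, sq_abs]; ring
  have hVV' : V x ^ 2 * ‖u x‖^2 = (|V x| * ‖u x‖)^2 := by rw [mul_pow, sq_abs]
  rw [hVV] at key
  rw [hVV']
  have hX : 0 ≤ ρ x ^ 2 * ∑ j, ‖Xop A j u x‖^2 := by positivity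
  have hu4 : 0 ≤ ρ x ^ 4 * ‖u x‖^2 := by positivity
  have hPP := sq_nonneg ‖Pop A U V u x‖
  have hMμ := mul_nonneg hM0 hμ
  have hfin : ‖Pop A U V u x‖^2 + M * μ * (ρ x ^ 2 * ∑ j, ‖Xop A j u x‖^2 + d * (ρ x ^ 4 * ‖u x‖^2))
      ≤ (1 + M * μ * (1 + d)) * eden A U V ρ u x := by
    unfold eden
    have e1 : 0 ≤ M * μ * d * (ρ x ^ 2 * ∑ j, ‖Xop A j u x‖^2) := by positivity
    have e2 : 0 ≤ M * μ * (ρ x ^ 4 * ‖u x‖^2) := by positivity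
    have e3 : 0 ≤ M * μ * (1 + d) * ‖Pop A U V u x‖^2 := by positivity
    nlinarith
  nlinarith [sq_nonneg (‖Pop A U V u x‖ - |V x| * ‖u x‖)]

set_option maxHeartbeats 1000000 in
lemma B_est (hS : Smooths A U V) {u : Rd d → ℂ} (hu : Test u) {ρ : Rd d → ℝ}
    (hρ : ContDiff ℝ ∞ ρ) (h1 : ∀ x, 1 ≤ ρ x) {M μ : ℝ} (hM0 : 0 ≤ M) (hμ : 0 ≤ μ)
    (j k : Fin d) (hB : ∀ x, |magB A j k x| ≤ μ * ρ x ^ 2)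
    (hM : ∀ i x, |pdR i (magB A j k) x| ≤ M * μ * ρ x ^ 3) :
    ∫ x, (magB A j k x ^ 2 * ‖u x‖^2) ≤ ((2 + 2 * M) * μ) * EE A U V ρ u := by
  have hBs : ContDiff ℝ ∞ (magB A j k) := (pdR_smooth (hS.hA k) j).sub (pdR_smooth (hS.hA j) k)
  have hBc := hBs.continuous
  set B := magB A j k with hBdef
  have hD := (Gf_integrable hS.hA k j hBs hu.smooth hu.comp).sub
    (Gf_integrable hS.hA j k hBs hu.smooth hu.comp)
  have hD0 : ∫ x, (pdC k (Gf A j B u) x - pdC j (Gf A k B u) x) = 0 := by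
    rw [integral_sub (Gf_integrable hS.hA k j hBs hu.smooth hu.comp)
      (Gf_integrable hS.hA j k hBs hu.smooth hu.comp), Gf_int hS.hA k j hBs hu.smooth hu.comp,
      Gf_int hS.hA j k hBs hu.smooth hu.comp, sub_zero]
  obtain ⟨hr1, hr2⟩ := re_int hD hD0
  unfold EE
  rw [← integral_const_mul]
  refine int_le (int_mul_u hu (by fun_prop)) ((int_eden hS hu hρ).const_mul _) hr1 hr2 (fun x => ?_)
  have hρ0 : 0 < ρ x := lt_of_lt_of_le one_pos (h1 x)
  have i1 := XX_identity hS.hA j k hBs hu.smooth x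
  have i2 := XX_identity hS.hA k j hBs hu.smooth x
  have i3 := Xop_commutator hS.hA j k hu.smooth x
  set N : ℂ := Xop A k u x * (B x * (starRingEnd ℂ) (Xop A j u x)
          + Complex.I * pdR j B x * (starRingEnd ℂ) (u x)) - 
       Xop A j u x * (B x * (starRingEnd ℂ) (Xop A k u x)
          + Complex.I * pdR k B x * (starRingEnd ℂ) (u x)) with hN
  have i4 : Complex.I * ((B x ^ 2 * ‖u x‖^2 : ℝ) : ℂ)
      = N + Complex.I * (pdC k (Gf A j B u) x - pdC j (Gf A k B u) x) := by
    have : Complex.I * ((B x ^ 2 * ‖u x‖^2 : ℝ) : ℂ)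
      = (Complex.I * B x * u x) * (B x * (starRingEnd ℂ) (u x)) := by
      push_cast
      rw [← Complex.mul_conj' (u x)]
      ring
    rw [this, hBdef, ← i3, sub_mul, i1, i2, hN]
    ring
  have i5 := congrArg Complex.im i4
  rw [Complex.add_im, Complex.I_mul_im, Complex.I_mul_im, Complex.ofReal_re] at i5
  have hN1 : N.im ≤ ‖Xop A k u x‖ * (|B x| * ‖Xop A j u x‖ + |pdR j B x| * ‖u x‖)
      + ‖Xop A j u x‖ * (|B x| * ‖Xop A k u x‖ + |pdR k B x| * ‖u x‖) := by
    refine (Complex.im_le_norm _).trans ?_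
    rw [hN]
    refine (norm_sub_le _ _).trans ?_
    rw [norm_mul, norm_mul]
    gcongr <;> refine (norm_add_le _ _).trans (le_of_eq ?_) <;> simp
  have hj := Finset.single_le_sum (f := fun i => ‖Xop A i u x‖^2) (fun i _ => sq_nonneg _) (Finset.mem_univ j)
  have hk := Finset.single_le_sum (f := fun i => ‖Xop A i u x‖^2) (fun i _ => sq_nonneg _) (Finset.mem_univ k)
  have hfin : μ * (2 + 2 * M) * (ρ x ^ 4 * ‖u x‖^2 + ρ x ^ 2 * ∑ j, ‖Xop A j u x‖^2)
      ≤ ((2 + 2 * M) * μ) * eden A U V ρ u x := by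
    unfold eden
    have e3 : 0 ≤ ((2 + 2 * M) * μ) * ‖Pop A U V u x‖^2 := by positivity
    nlinarith
  set a := ‖Xop A j u x‖
  set b := ‖Xop A k u x‖
  set S := ∑ j, ‖Xop A j u x‖^2
  have ha : 0 ≤ a := norm_nonneg _
  have hb : 0 ≤ b := norm_nonneg _
  have hN2 : N.im ≤ b * (μ * ρ x ^ 2 * a + M * μ * ρ x ^ 3 * ‖u x‖)
      + a * (μ * ρ x ^ 2 * b + M * μ * ρ x ^ 3 * ‖u x‖) := by
    refine hN1.trans ?_
    gcongr
    · exact hB x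
    · exact hM j x
    · exact hB x
    · exact hM k x
  have f1 : μ * ρ x ^ 2 * (2 * (a * b)) ≤ μ * ρ x ^ 2 * (2 * S) := by
    gcongr; nlinarith [sq_nonneg (a - b)]
  have f2 : ∀ c : ℝ, c^2 ≤ S → M * μ * (ρ x ^ 3 * ‖u x‖ * c) ≤ M * μ * ((ρ x ^ 4 * ‖u x‖^2 + ρ x ^ 2 * S)/2) := by
    intro c hc
    gcongr
    have := mul_le_mul_of_nonneg_left hc (sq_nonneg (ρ x))
    nlinarith [sq_nonneg (ρ x ^2 * ‖u x‖ - ρ x * c)]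
  have f3 := f2 a hj
  have f4 := f2 b hk
  have f5 : 0 ≤ μ * (ρ x ^ 4 * ‖u x‖^2) := by positivity
  have hS0 : 0 ≤ S := le_trans (sq_nonneg a) hj
  have f7 : 0 ≤ ρ x ^ 4 * ‖u x‖^2 + ρ x ^ 2 * S :=
    add_nonneg (by positivity) (mul_nonneg (sq_nonneg _) hS0)
  have f6 : 0 ≤ M * μ * (ρ x ^ 4 * ‖u x‖^2 + ρ x ^ 2 * S) := mul_nonneg (mul_nonneg hM0 hμ) f7
  clear_value S a b N
  have hfin2 : N.im ≤ ((2 + 2 * M) * μ) * eden A U V ρ u x := by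
    refine le_trans ?_ hfin
    linarith
  show _ ≤ _ + (pdC k (Gf A j B u) x - pdC j (Gf A k B u) x).re
  linarith

set_option maxHeartbeats 1000000 in
lemma step_est (hS : Smooths A U V) {u : Rd d → ℂ} (hu : Test u) {ρ φ ψ : Rd d → ℝ}
    (hρ : ContDiff ℝ ∞ ρ) (hφ : ContDiff ℝ ∞ φ) (hψ : ContDiff ℝ ∞ ψ)
    (h1 : ∀ x, 1 ≤ ρ x) {M : ℝ} (hM1 : 1 ≤ M) (j : Fin d)
    (hρM : ∀ x, |pdR j ρ x| ≤ M * ρ x ^ 2)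
    (hψM : ∀ x, |ψ x| ≤ M) (hψM' : ∀ x, |pdR j ψ x| ≤ M * ρ x)
    (hφψ : ∀ x, |ρ x * ψ x - pdR j φ x| ≤ M * ρ x * |φ x|) {ε : ℝ} (hε : 0 < ε) :
    ∫ x, (ρ x ^ 4 * ψ x ^ 2) * ‖u x‖^2
      ≤ ε * EE A U V ρ u + (5 * M^2)^2 / (2 * ε) * ∫ x, (ρ x ^ 4 * φ x ^ 2) * ‖u x‖^2 := by
  have hρc := hρ.continuous
  have hφc := hφ.continuous
  have hψc := hψ.continuous
  have hn : ContDiff ℝ ∞ (fun x => ‖u x‖^2) := hu.smooth.norm_sq ℝ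
  set Ψ : Rd d → ℝ := fun x => ρ x ^ 3 * ψ x * φ x * ‖u x‖^2 with hΨ
  have hΨs : ContDiff ℝ ∞ Ψ := (((hρ.pow 3).mul hψ).mul hφ).mul hn
  have hΨc : HasCompactSupport Ψ :=
    HasCompactSupport.intro hu.comp (fun x hx => by simp [hΨ, zero_of_notMem hx])
  have hI0 : ∫ x, pdR j Ψ x = 0 := integral_fderiv_zero hΨs hΨc _
  have hI1 : Integrable (pdR j Ψ) :=
    (pdR_smooth hΨs j).continuous.integrable_of_hasCompactSupport (hΨc.fderiv_apply ℝ _)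
  unfold EE
  rw [← integral_const_mul, ← integral_const_mul, ← integral_add ((int_eden hS hu hρ).const_mul _)
    ((int_mul_u hu (by fun_prop)).const_mul _)]
  refine int_le (int_mul_u hu (by fun_prop)) (((int_eden hS hu hρ).const_mul _).add
    ((int_mul_u hu (by fun_prop)).const_mul _)) hI1 hI0 (fun x => ?_)
  have hρ0 : 0 < ρ x := lt_of_lt_of_le one_pos (h1 x)
  have hd := pdR_eq hΨs (j := j) (x := x)
    (((((pdR_line hρ j x).pow 3).mul (pdR_line hψ j x)).mul (pdR_line hφ j x)).mul (pdR_line hn j x))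
  simp only [zero_smul, add_zero, Pi.mul_apply, Pi.pow_apply] at hd
  norm_num at hd
  have hnp := normSq_pd A j hu.smooth x
  have hj := Finset.single_le_sum (f := fun i => ‖Xop A i u x‖^2) (fun i _ => sq_nonneg _) (Finset.mem_univ j)
  have hM0 : 0 ≤ M := by linarith
  have hMM : M ≤ M^2 := by nlinarith
  have e1 : ε * (ρ x ^ 4 * ‖u x‖^2 + ρ x ^ 2 * ‖Xop A j u x‖^2) ≤ ε * eden A U V ρ u x := by
    gcongr
    unfold eden
    have := mul_le_mul_of_nonneg_left hj (sq_nonneg (ρ x))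
    nlinarith [sq_nonneg ‖Pop A U V u x‖]
  set a := ‖Xop A j u x‖
  set n := ‖u x‖
  have ha : 0 ≤ a := norm_nonneg _
  have hn0 : 0 ≤ n := norm_nonneg _
  have t1 : |φ x * (3 * ρ x ^ 2 * pdR j ρ x * ψ x * n^2)| ≤ |φ x| * (3 * ρ x ^ 2 * (M * ρ x ^2) * M * n^2) := by
    rw [abs_mul, abs_mul, abs_mul, abs_mul, abs_of_nonneg (by positivity : 0 ≤ n^2),
      abs_of_nonneg (by positivity : 0 ≤ 3 * ρ x ^ 2)]
    gcongr
    · exact hρM x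
    · exact hψM x
  have t2 : |φ x * (ρ x ^ 3 * pdR j ψ x * n^2)| ≤ |φ x| * (ρ x ^ 3 * (M * ρ x) * n^2) := by
    rw [abs_mul, abs_mul, abs_mul, abs_of_nonneg (by positivity : 0 ≤ n^2),
      abs_of_nonneg (by positivity : 0 ≤ ρ x ^ 3)]
    gcongr
    exact hψM' x
  have t3 : |φ x * (ρ x ^ 3 * ψ x * pdR j (fun x => ‖u x‖^2) x)| ≤ |φ x| * (ρ x ^ 3 * M * (2 * (n * a))) := by
    rw [abs_mul, abs_mul, abs_mul, abs_of_nonneg (by positivity : 0 ≤ ρ x ^ 3)]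
    gcongr
    exact hψM x
  have t4 : |(ρ x ^ 3 * ψ x * n^2) * (ρ x * ψ x - pdR j φ x)| ≤ (ρ x ^ 3 * M * n^2) * (M * ρ x * |φ x|) := by
    rw [abs_mul, abs_mul, abs_mul, abs_of_nonneg (by positivity : 0 ≤ n^2),
      abs_of_nonneg (by positivity : 0 ≤ ρ x ^ 3)]
    gcongr
    · exact hψM x
    · exact hφψ x
  have ident : ρ x ^ 4 * ψ x ^ 2 * n^2 = pdR j Ψ x
      - φ x * (3 * ρ x ^ 2 * pdR j ρ x * ψ x * n^2)
      - φ x * (ρ x ^ 3 * pdR j ψ x * n^2)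
      - φ x * (ρ x ^ 3 * ψ x * pdR j (fun x => ‖u x‖^2) x)
      + (ρ x ^ 3 * ψ x * n^2) * (ρ x * ψ x - pdR j φ x) := by
    rw [hd]; ring
  have b1 := neg_abs_le (φ x * (3 * ρ x ^ 2 * pdR j ρ x * ψ x * n^2))
  have b2 := neg_abs_le (φ x * (ρ x ^ 3 * pdR j ψ x * n^2))
  have b3 := neg_abs_le (φ x * (ρ x ^ 3 * ψ x * pdR j (fun x => ‖u x‖^2) x))
  have b4 := le_abs_self ((ρ x ^ 3 * ψ x * n^2) * (ρ x * ψ x - pdR j φ x))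
  set q := ρ x ^ 2 * |φ x| * n with hq
  have hq0 : 0 ≤ q := by positivity
  have bound : ρ x ^ 4 * ψ x ^ 2 * n^2 ≤ pdR j Ψ x
      + (5 * M^2) * (q * (ρ x ^ 2 * n)) + (5 * M^2) * (q * (ρ x * a)) := by
    have c1 : M * (q * (ρ x ^ 2 * n)) ≤ M^2 * (q * (ρ x ^ 2 * n)) := by gcongr
    have c2 : 2 * M * (q * (ρ x * a)) ≤ 5 * M^2 * (q * (ρ x * a)) := by
      gcongr
      norm_num
    rw [ident]
    have : |φ x| * (3 * ρ x ^ 2 * (M * ρ x ^2) * M * n^2) + |φ x| * (ρ x ^ 3 * (M * ρ x) * n^2)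
        + |φ x| * (ρ x ^ 3 * M * (2 * (n * a))) + (ρ x ^ 3 * M * n^2) * (M * ρ x * |φ x|)
        = 4 * M^2 * (q * (ρ x ^ 2 * n)) + M * (q * (ρ x ^ 2 * n)) + 2 * M * (q * (ρ x * a)) := by
      rw [hq]; ring
    linarith
  have young : (5 * M^2) * (q * (ρ x ^ 2 * n)) + (5 * M^2) * (q * (ρ x * a))
      ≤ ε * (ρ x ^ 4 * n^2 + ρ x ^ 2 * a^2) + (5 * M^2)^2 / (2 * ε) * (ρ x ^ 4 * φ x ^ 2 * n^2) := by
    have e2 : ρ x ^ 4 * φ x ^ 2 * n^2 = q^2 := by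
      rw [hq, mul_pow, mul_pow, sq_abs]; ring
    rw [e2]
    have gen : ∀ K y : ℝ, K * (q * y) ≤ ε * y^2 + K^2 / (4 * ε) * q^2 := by
      intro K y
      have : ε * y^2 + K^2 / (4 * ε) * q^2 - K * (q * y) = ε * (y - K / (2*ε) * q)^2 := by
        field_simp
        ring
      have h2 : 0 ≤ ε * (y - K / (2*ε) * q)^2 := by positivity
      linarith
    have g1 := gen (5 * M^2) (ρ x ^ 2 * n)
    have g2 := gen (5 * M^2) (ρ x * a)
    have e3 : (5 * M^2)^2 / (2 * ε) * q^2 = (5 * M^2)^2 / (4 * ε) * q^2 + (5 * M^2)^2 / (4 * ε) * q^2 := by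
      field_simp; ring
    rw [e3]
    nlinarith
  show _ ≤ (_ + _) + _
  linarith

end estimates

section weight
variable {d : ℕ} {ι : Type*}

/-- the weight to the power `2N` -/
def Qf (T : Finset ι) (f : ι → Rd d → ℝ) (s : ι → ℕ) (N : ℕ) (μ : ℝ) (x : Rd d) : ℝ :=
  1 + ∑ i ∈ T, (f i x / μ) ^ (2 * (N / s i))

/-- the weight -/
def rho (T : Finset ι) (f : ι → Rd d → ℝ) (s : ι → ℕ) (N : ℕ) (μ : ℝ) (x : Rd d) : ℝ :=
  (Qf T f s N μ x) ^ ((1 : ℝ) / ((2 * N : ℕ) : ℝ))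

/-- normalised functions -/
def phi (T : Finset ι) (f : ι → Rd d → ℝ) (s : ι → ℕ) (N : ℕ) (μ : ℝ) (i : ι) (x : Rd d) : ℝ :=
  f i x / (μ * rho T f s N μ x ^ (s i))

variable {T : Finset ι} {f : ι → Rd d → ℝ} {s : ι → ℕ} {N : ℕ} {μ : ℝ}

lemma Qf_ge_one (x : Rd d) : 1 ≤ Qf T f s N μ x := by
  unfold Qf
  have : 0 ≤ ∑ i ∈ T, (f i x / μ) ^ (2 * (N / s i)) :=
    Finset.sum_nonneg (fun i _ => (even_two_mul _).pow_nonneg _)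
  linarith

lemma rho_ge_one (x : Rd d) : 1 ≤ rho T f s N μ x :=
  Real.one_le_rpow (Qf_ge_one x) (by positivity)

lemma rho_pos (x : Rd d) : 0 < rho T f s N μ x := lt_of_lt_of_le one_pos (rho_ge_one x)

lemma rho_pow (hN : 2 ≤ N) (x : Rd d) : rho T f s N μ x ^ (2 * N) = Qf T f s N μ x := by
  unfold rho
  rw [one_div]
  exact Real.rpow_inv_natCast_pow (by linarith [Qf_ge_one (T := T) (f := f) (s := s) (N := N) (μ := μ) x])
    (by omega)

lemma Qf_smooth (hf : ∀ i ∈ T, ContDiff ℝ ∞ (f i)) : ContDiff ℝ ∞ (Qf T f s N μ) := by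
  unfold Qf
  exact contDiff_const.add (ContDiff.sum (fun i hi => ((hf i hi).div_const _).pow _))

lemma rho_smooth (hf : ∀ i ∈ T, ContDiff ℝ ∞ (f i)) : ContDiff ℝ ∞ (rho T f s N μ) := by
  unfold rho
  exact (Qf_smooth hf).rpow_const_of_ne (fun x => by
    linarith [Qf_ge_one (T := T) (f := f) (s := s) (N := N) (μ := μ) x])

lemma phi_smooth (hμ : 0 < μ) (hf : ∀ i ∈ T, ContDiff ℝ ∞ (f i)) {i : ι} (hi : i ∈ T) :
    ContDiff ℝ ∞ (phi T f s N μ i) := by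
  unfold phi
  refine (hf i hi).div (contDiff_const.mul ((rho_smooth hf).pow _)) (fun x => ?_)
  have := rho_pos (T := T) (f := f) (s := s) (N := N) (μ := μ) x
  positivity

lemma f_le (hN : 2 ≤ N) (hμ : 0 < μ) (hs : ∀ i ∈ T, s i ∣ N) {i : ι} (hi : i ∈ T) (x : Rd d) :
    |f i x| ≤ μ * rho T f s N μ x ^ (s i) := by
  have hρ := rho_pos (T := T) (f := f) (s := s) (N := N) (μ := μ) x
  obtain ⟨m, hm⟩ := hs i hi
  have hsi : 0 < s i := Nat.pos_of_ne_zero (by rintro h; rw [h] at hm; omega)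
  have hdiv : N / s i = m := by rw [hm]; exact Nat.mul_div_cancel_left m hsi
  have hm0 : m ≠ 0 := by rintro h; rw [h] at hm; omega
  have h1 : (|f i x| / μ) ^ (2 * m) ≤ (rho T f s N μ x ^ (s i)) ^ (2 * m) := by
    rw [← pow_mul, show s i * (2 * m) = 2 * N by rw [hm]; ring, rho_pow hN]
    have h2 := Finset.single_le_sum (f := fun i => (f i x / μ) ^ (2 * (N / s i)))
      (fun i _ => (even_two_mul _).pow_nonneg _) hi
    have h3 : (|f i x| / μ) ^ (2 * m) = (f i x / μ) ^ (2 * (N / s i)) := by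
      rw [hdiv, pow_mul, pow_mul, div_pow, sq_abs, ← div_pow]
    rw [h3]
    unfold Qf
    linarith
  have h4 := le_of_pow_le_pow_left₀ (by omega) (by positivity) h1
  rwa [div_le_iff₀ hμ, mul_comm] at h4

lemma phi_le (hN : 2 ≤ N) (hμ : 0 < μ) (hs : ∀ i ∈ T, s i ∣ N) {i : ι} (hi : i ∈ T) (x : Rd d) :
    |phi T f s N μ i x| ≤ 1 := by
  have hρ := rho_pos (T := T) (f := f) (s := s) (N := N) (μ := μ) x
  unfold phi
  rw [abs_div, abs_of_pos (by positivity : 0 < μ * rho T f s N μ x ^ s i), div_le_one (by positivity)]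
  exact f_le hN hμ hs hi x

lemma rho_four (hN : 2 ≤ N) (hμ : 0 < μ) (hs : ∀ i ∈ T, s i ∣ N) (x : Rd d) :
    rho T f s N μ x ^ 4 ≤ 1 + ∑ i ∈ T, rho T f s N μ x ^ 4 * phi T f s N μ i x ^ 2 := by
  have hρ := rho_pos (T := T) (f := f) (s := s) (N := N) (μ := μ) x
  have hρ1 := rho_ge_one (T := T) (f := f) (s := s) (N := N) (μ := μ) x
  have h1 : rho T f s N μ x ^ (2 * N) ≤ 1 + ∑ i ∈ T, rho T f s N μ x ^ (2*N) * phi T f s N μ i x ^ 2 := by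
    conv_lhs => rw [rho_pow hN]
    unfold Qf
    gcongr with i hi
    obtain ⟨m, hm⟩ := hs i hi
    have hsi : 0 < s i := Nat.pos_of_ne_zero (by rintro h; rw [h] at hm; omega)
    have hdiv : N / s i = m := by rw [hm]; exact Nat.mul_div_cancel_left m hsi
    have hm0 : m ≠ 0 := by rintro h; rw [h] at hm; omega
    have e : f i x / μ = rho T f s N μ x ^ (s i) * phi T f s N μ i x := by
      unfold phi; field_simp
    rw [hdiv, e, mul_pow, ← pow_mul, show s i * (2 * m) = 2 * N by rw [hm]; ring, pow_mul (phi T f s N μ i x)]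
    gcongr
    refine pow_le_of_le_one (sq_nonneg _) ?_ hm0
    rw [← sq_abs]
    exact pow_le_one₀ (abs_nonneg _) (phi_le hN hμ hs hi x)
  obtain ⟨k, hk⟩ : ∃ k, 2 * N = 4 + k := ⟨2 * N - 4, by omega⟩
  rw [← Finset.mul_sum] at h1 ⊢
  rw [hk, pow_add] at h1
  set S := ∑ i ∈ T, phi T f s N μ i x ^ 2
  have hk1 : 1 ≤ rho T f s N μ x ^ k := one_le_pow₀ hρ1
  by_contra hcon
  push Not at hcon
  have : rho T f s N μ x ^ k * 1 < rho T f s N μ x ^ k * (rho T f s N μ x ^ 4 - rho T f s N μ x ^ 4 * S) := by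
    apply mul_lt_mul_of_pos_left _ (by positivity)
    linarith
  nlinarith

lemma rho_grad (hN : 2 ≤ N) (hμ : 0 < μ) (hf : ∀ i ∈ T, ContDiff ℝ ∞ (f i)) (hs : ∀ i ∈ T, s i ∣ N)
    {M : ℝ} (j : Fin d) (x : Rd d)
    (hM : ∀ i ∈ T, |pdR j (f i) x| ≤ M * μ * rho T f s N μ x ^ (s i + 1)) :
    |pdR j (rho T f s N μ) x| ≤ T.card * M * rho T f s N μ x ^ 2 := by
  have hρ := rho_pos (T := T) (f := f) (s := s) (N := N) (μ := μ) x
  have hρs : ContDiff ℝ ∞ (rho T f s N μ) := rho_smooth hf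
  have h1 := pdR_eq (hρs.pow (2 * N)) (j := j) (x := x) ((pdR_line hρs j x).pow (2 * N))
  have e : (fun y => rho T f s N μ y ^ (2 * N)) = Qf T f s N μ := by
    funext y; exact rho_pow hN y
  rw [e] at h1
  have h2 : pdR j (Qf T f s N μ) x = ∑ i ∈ T, ((2 * (N / s i) : ℕ) : ℝ) * (f i x / μ) ^ (2 * (N / s i) - 1)
      * (pdR j (f i) x / μ) := by
    refine pdR_eq (Qf_smooth hf) ?_
    have := HasDerivAt.fun_sum (u := T) (fun i hi => (((pdR_line (hf i hi) j x).div_const μ).pow (2 * (N / s i))))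
    simp only [zero_smul, add_zero] at this
    exact this.const_add 1
  rw [h2] at h1
  simp only [zero_smul, add_zero] at h1
  set R := rho T f s N μ x
  have hterm : ∀ i ∈ T, |((2 * (N / s i) : ℕ) : ℝ) * (f i x / μ) ^ (2 * (N / s i) - 1)
      * (pdR j (f i) x / μ)| ≤ (2 * N : ℕ) * (M * R ^ (2 * N + 1)) := by
    intro i hi
    obtain ⟨m, hm⟩ := hs i hi
    have hsi : 0 < s i := Nat.pos_of_ne_zero (by rintro h; rw [h] at hm; omega)
    have hdiv : N / s i = m := by rw [hm]; exact Nat.mul_div_cancel_left m hsi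
    have hm0 : m ≠ 0 := by rintro h; rw [h] at hm; omega
    have hmN : m ≤ N := by rw [hm]; exact Nat.le_mul_of_pos_left m hsi
    have a1 : |f i x / μ| ≤ R ^ (s i) := by
      rw [abs_div, abs_of_pos hμ, div_le_iff₀ hμ, mul_comm]
      exact f_le hN hμ hs hi x
    have a2 : |pdR j (f i) x / μ| ≤ M * R ^ (s i + 1) := by
      rw [abs_div, abs_of_pos hμ, div_le_iff₀ hμ]
      refine (hM i hi).trans (le_of_eq ?_)
      ring
    rw [hdiv, abs_mul, abs_mul, abs_pow, Nat.abs_cast]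
    have hMR : 0 ≤ M * R ^ (s i + 1) := (abs_nonneg _).trans a2
    calc ((2 * m : ℕ) : ℝ) * |f i x / μ| ^ (2 * m - 1) * |pdR j (f i) x / μ|
        ≤ ((2 * N : ℕ) : ℝ) * (R ^ (s i)) ^ (2 * m - 1) * (M * R ^ (s i + 1)) := by gcongr
      _ = _ := by
        obtain ⟨l, hl⟩ : ∃ l, 2 * m = l + 1 := ⟨2 * m - 1, by omega⟩
        have : 2 * N + 1 = s i * l + (s i + 1) := by
          rw [hm]
          calc 2 * (s i * m) + 1 = s i * (2 * m) + 1 := by ring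
            _ = _ := by rw [hl]; ring
        rw [hl, Nat.add_sub_cancel, this, pow_add R (s i * l), pow_mul R (s i) l]
        ring
  have h3 := (Finset.abs_sum_le_sum_abs _ _).trans (Finset.sum_le_sum hterm)
  rw [h1, abs_mul, abs_mul, Nat.abs_cast, abs_of_pos (by positivity : 0 < R ^ (2 * N - 1)),
    Finset.sum_const, nsmul_eq_mul] at h3
  obtain ⟨l, hl⟩ : ∃ l, 2 * N = l + 1 := ⟨2 * N - 1, by omega⟩
  have hN0 : (0:ℝ) < ((2 * N : ℕ) : ℝ) := by exact_mod_cast (by omega : 0 < 2 * N)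
  have hpos : 0 < ((2 * N : ℕ) : ℝ) * R ^ (2 * N - 1) := by positivity
  refine le_of_mul_le_mul_left (h3.trans (le_of_eq ?_)) hpos
  have e1 : R ^ (2 * N + 1) = R ^ (2 * N - 1) * R ^ 2 := by
    rw [← pow_add]; congr 1; omega
  rw [e1]
  ring

lemma phi_pd (hμ : 0 < μ) (hf : ∀ i ∈ T, ContDiff ℝ ∞ (f i)) {i : ι} (hi : i ∈ T) (j : Fin d) (x : Rd d) :
    pdR j (phi T f s N μ i) x = pdR j (f i) x / (μ * rho T f s N μ x ^ (s i))
      - s i * (pdR j (rho T f s N μ) x / rho T f s N μ x) * phi T f s N μ i x := by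
  have hρ := rho_pos (T := T) (f := f) (s := s) (N := N) (μ := μ) x
  have hρs : ContDiff ℝ ∞ (rho T f s N μ) := rho_smooth hf
  have hne : μ * rho T f s N μ (x + (0:ℝ) • ee j) ^ (s i) ≠ 0 := by
    simp only [zero_smul, add_zero]; positivity
  have h1 := pdR_eq (phi_smooth (s := s) (N := N) hμ hf hi) (j := j) (x := x)
    ((pdR_line (hf i hi) j x).div (((pdR_line hρs j x).pow (s i)).const_mul μ) hne)
  rw [h1]
  simp only [zero_smul, add_zero]
  unfold phi
  rcases Nat.eq_zero_or_pos (s i) with h0 | h0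
  · simp [h0]; field_simp
  · obtain ⟨l, hl⟩ : ∃ l, s i = l + 1 := ⟨s i - 1, by omega⟩
    rw [hl, Nat.add_sub_cancel]
    field_simp
    ring

lemma phi_pd_le (hN : 2 ≤ N) (hμ : 0 < μ) (hf : ∀ i ∈ T, ContDiff ℝ ∞ (f i)) (hs : ∀ i ∈ T, s i ∣ N)
    {M M₂ : ℝ} (j : Fin d) (x : Rd d) (hM : ∀ i ∈ T, |pdR j (f i) x| ≤ M * μ * rho T f s N μ x ^ (s i + 1))
    (hM2 : |pdR j (rho T f s N μ) x| ≤ M₂ * rho T f s N μ x ^ 2)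
    {i : ι} (hi : i ∈ T) :
    |pdR j (phi T f s N μ i) x| ≤ (M + s i * M₂) * rho T f s N μ x := by
  have hρ := rho_pos (T := T) (f := f) (s := s) (N := N) (μ := μ) x
  rw [phi_pd hμ hf hi]
  refine (abs_sub _ _).trans ?_
  have h1 : |pdR j (f i) x / (μ * rho T f s N μ x ^ (s i))| ≤ M * rho T f s N μ x := by
    rw [abs_div, abs_of_pos (by positivity : 0 < μ * rho T f s N μ x ^ s i), div_le_iff₀ (by positivity)]
    refine (hM i hi).trans (le_of_eq ?_)
    ring
  have h2 : |pdR j (rho T f s N μ) x / rho T f s N μ x| ≤ M₂ * rho T f s N μ x := by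
    rw [abs_div, abs_of_pos hρ, div_le_iff₀ hρ]
    refine hM2.trans (le_of_eq ?_)
    ring
  rw [abs_mul, abs_mul, Nat.abs_cast]
  have h3 := phi_le (f := f) hN hμ hs hi x
  have h4 : (s i : ℝ) * |pdR j (rho T f s N μ) x / rho T f s N μ x| * |phi T f s N μ i x|
      ≤ s i * (M₂ * rho T f s N μ x) * 1 := by
    have := (abs_nonneg _).trans h2
    gcongr
  linarith

lemma phi_diff (hμ : 0 < μ) (hf : ∀ i ∈ T, ContDiff ℝ ∞ (f i))
    {M₂ : ℝ} (j : Fin d) (x : Rd d)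
    (hM2 : |pdR j (rho T f s N μ) x| ≤ M₂ * rho T f s N μ x ^ 2)
    {i i' : ι} (hi : i ∈ T) (hi' : pdR j (f i) = f i') (hs' : s i' = s i + 1) :
    |rho T f s N μ x * phi T f s N μ i' x - pdR j (phi T f s N μ i) x|
      ≤ (s i * M₂) * rho T f s N μ x * |phi T f s N μ i x| := by
  have hρ := rho_pos (T := T) (f := f) (s := s) (N := N) (μ := μ) x
  have h2 : |pdR j (rho T f s N μ) x / rho T f s N μ x| ≤ M₂ * rho T f s N μ x := by
    rw [abs_div, abs_of_pos hρ, div_le_iff₀ hρ]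
    refine hM2.trans (le_of_eq ?_)
    ring
  have e : rho T f s N μ x * phi T f s N μ i' x - pdR j (phi T f s N μ i) x
      = s i * (pdR j (rho T f s N μ) x / rho T f s N μ x) * phi T f s N μ i x := by
    rw [phi_pd hμ hf hi, hi']
    have : rho T f s N μ x * phi T f s N μ i' x = f i' x / (μ * rho T f s N μ x ^ (s i)) := by
      unfold phi
      rw [hs', pow_succ]
      field_simp
    rw [this]
    ring
  rw [e, abs_mul, abs_mul, Nat.abs_cast]
  have : (s i : ℝ) * |pdR j (rho T f s N μ) x / rho T f s N μ x| ≤ s i * M₂ * rho T f s N μ x := by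
    rw [mul_assoc]; gcongr
  gcongr

end weight

section final
variable {d p : ℕ}

/-- index type of the basic functions -/
abbrev Kap (d p : ℕ) := Fin p ⊕ ({jk : Fin d × Fin d // jk.1 < jk.2} ⊕ Unit)

/-- basic functions -/
def Fk (A : Fin d → Rd d → ℝ) (U : Fin p → Rd d → ℝ) (V : Rd d → ℝ) : Kap d p → Rd d → ℝ
  | .inl l => U l
  | .inr (.inl jk) => magB A jk.1.1 jk.1.2
  | .inr (.inr _) => V

/-- weights of the basic functions -/
def wk : Kap d p → ℕ
  | .inl _ => 1
  | .inr _ => 2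

/-- all derivatives -/
def ff (A : Fin d → Rd d → ℝ) (U : Fin p → Rd d → ℝ) (V : Rd d → ℝ)
    (i : Kap d p × (Fin d → ℕ)) : Rd d → ℝ := pdMulti i.2 (Fk A U V i.1)

/-- all weights -/
def sw (i : Kap d p × (Fin d → ℕ)) : ℕ := wk i.1 + ∑ j, i.2 j

/-- the finite index set -/
def TT (d p r : ℕ) : Finset (Kap d p × (Fin d → ℕ)) :=
  (Finset.univ ×ˢ (Finset.range (r+2)).biUnion (mIdx d)).filter (fun i => sw i ≤ r + 1)

lemma mem_TT {r : ℕ} {i : Kap d p × (Fin d → ℕ)} : i ∈ TT d p r ↔ sw i ≤ r + 1 := by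
  unfold TT
  rw [Finset.mem_filter, Finset.mem_product, Finset.mem_biUnion]
  refine ⟨fun h => h.2, fun h => ⟨⟨Finset.mem_univ _, ∑ j, i.2 j, ?_, mem_mIdx.2 rfl⟩, h⟩⟩
  unfold sw at h
  rw [Finset.mem_range]; omega

lemma wk_pos (k : Kap d p) : 1 ≤ wk k := by
  rcases k with _ | _ <;> simp [wk]

lemma sw_pos (i : Kap d p × (Fin d → ℕ)) : 1 ≤ sw i := by
  have := wk_pos i.1; unfold sw; omega

lemma sw_succ (k : Kap d p) (α : Fin d → ℕ) (j : Fin d) :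
    sw (k, α + Pi.single j 1) = sw (k, α) + 1 := by
  unfold sw
  simp only [Pi.add_apply, Finset.sum_add_distrib, Finset.sum_pi_single', Finset.mem_univ, if_true]
  omega

variable {A : Fin d → Rd d → ℝ} {U : Fin p → Rd d → ℝ} {V : Rd d → ℝ}

lemma Fk_smooth (hS : Smooths A U V) (k : Kap d p) : ContDiff ℝ ∞ (Fk A U V k) := by
  rcases k with l | jk | _
  · exact hS.hU l
  · exact (pdR_smooth (hS.hA _) _).sub (pdR_smooth (hS.hA _) _)
  · exact hS.hV

lemma ff_smooth (hS : Smooths A U V) (i : Kap d p × (Fin d → ℕ)) : ContDiff ℝ ∞ (ff A U V i) :=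
  pdMulti_smooth _ (Fk_smooth hS _)

lemma ff_succ (hS : Smooths A U V) (k : Kap d p) (α : Fin d → ℕ) (j : Fin d) :
    pdR j (ff A U V (k, α)) = ff A U V (k, α + Pi.single j 1) :=
  pdMulti_succ α j (Fk_smooth hS k)

lemma mq_ge {q : ℕ} {i : Kap d p × (Fin d → ℕ)} (hi : sw i = q + 2) (x : Rd d) :
    |ff A U V i x| ≤ mq A U V (q + 1) x := by
  obtain ⟨k, α⟩ := i
  have n1 : 0 ≤ ∑ l, ∑ α ∈ mIdx d (q+1), |pdMulti α (U l) x| :=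
    Finset.sum_nonneg fun _ _ => Finset.sum_nonneg fun _ _ => abs_nonneg _
  have n2 : 0 ≤ ∑ jk ∈ Finset.univ.filter (fun jk : Fin d × Fin d => jk.1 < jk.2),
          ∑ α ∈ mIdx d q, |pdMulti α (magB A jk.1 jk.2) x| :=
    Finset.sum_nonneg fun _ _ => Finset.sum_nonneg fun _ _ => abs_nonneg _
  have n3 : 0 ≤ ∑ α ∈ mIdx d q, |pdMulti α V x| := Finset.sum_nonneg fun _ _ => abs_nonneg _
  rcases k with l | jk | _
  · have hα : α ∈ mIdx d (q+1) := mem_mIdx.2 (by simp [sw, wk] at hi; omega)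
    have h1 := Finset.single_le_sum (f := fun α => |pdMulti α (U l) x|) (fun _ _ => abs_nonneg _) hα
    have h2 := Finset.single_le_sum (f := fun l => ∑ α ∈ mIdx d (q+1), |pdMulti α (U l) x|)
      (fun _ _ => Finset.sum_nonneg fun _ _ => abs_nonneg _) (Finset.mem_univ l)
    simp only [mq, ff, Fk]
    linarith
  · have hα : α ∈ mIdx d q := mem_mIdx.2 (by simp [sw, wk] at hi; omega)
    have h1 := Finset.single_le_sum (f := fun α => |pdMulti α (magB A jk.1.1 jk.1.2) x|)
      (fun _ _ => abs_nonneg _) hα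
    have h2 := Finset.single_le_sum
      (f := fun jk : Fin d × Fin d => ∑ α ∈ mIdx d q, |pdMulti α (magB A jk.1 jk.2) x|)
      (s := Finset.univ.filter (fun jk : Fin d × Fin d => jk.1 < jk.2)) (a := jk.1)
      (fun _ _ => Finset.sum_nonneg fun _ _ => abs_nonneg _) (by simpa using jk.2)
    simp only [mq, ff, Fk]
    linarith
  · have hα : α ∈ mIdx d q := mem_mIdx.2 (by simp [sw, wk] at hi; omega)
    have h1 := Finset.single_le_sum (f := fun α => |pdMulti α V x|) (fun _ _ => abs_nonneg _) hα
    simp only [mq, ff, Fk]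
    linarith

lemma mq_le (A : Fin d → Rd d → ℝ) (U : Fin p → Rd d → ℝ) (V : Rd d → ℝ) (q : ℕ) :
    ∃ L : ℝ, 0 ≤ L ∧ ∀ x K, (∀ i : Kap d p × (Fin d → ℕ), sw i = q + 1 → |ff A U V i x| ≤ K) →
      mq A U V q x ≤ L * K := by
  rcases q with _ | q
  · refine ⟨p, by positivity, fun x K h => ?_⟩
    have : ∀ l ∈ (Finset.univ : Finset (Fin p)), |U l x| ≤ K := fun l _ => by
      have := h (.inl l, 0) (by simp [sw, wk])
      simpa [ff, Fk, pdMulti_zero] using this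
    simpa [mq] using Finset.sum_le_card_nsmul _ _ _ this
  · refine ⟨p * (mIdx d (q+1)).card
      + (Finset.univ.filter (fun jk : Fin d × Fin d => jk.1 < jk.2)).card * (mIdx d q).card
      + (mIdx d q).card, by positivity, fun x K h => ?_⟩
    have h1 : ∑ l, ∑ α ∈ mIdx d (q+1), |pdMulti α (U l) x| ≤ p * (mIdx d (q+1)).card * K := by
      refine (Finset.sum_le_card_nsmul _ _ ((mIdx d (q+1)).card * K) fun l _ => ?_).trans
        (le_of_eq (by simp; ring))
      rw [← nsmul_eq_mul]
      refine Finset.sum_le_card_nsmul _ _ _ fun α hα => ?_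
      rw [mem_mIdx] at hα
      exact h (.inl l, α) (by simp [sw, wk, hα]; omega)
    have h2 : ∑ jk ∈ Finset.univ.filter (fun jk : Fin d × Fin d => jk.1 < jk.2),
          ∑ α ∈ mIdx d q, |pdMulti α (magB A jk.1 jk.2) x|
        ≤ (Finset.univ.filter (fun jk : Fin d × Fin d => jk.1 < jk.2)).card * (mIdx d q).card * K := by
      refine (Finset.sum_le_card_nsmul _ _ ((mIdx d q).card * K) fun jk hjk => ?_).trans
        (le_of_eq (by rw [nsmul_eq_mul]; ring))
      rw [← nsmul_eq_mul]
      refine Finset.sum_le_card_nsmul _ _ _ fun α hα => ?_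
      rw [mem_mIdx] at hα
      exact h (.inr (.inl ⟨jk, by simpa using hjk⟩), α) (by simp [sw, wk, hα]; omega)
    have h3 : ∑ α ∈ mIdx d q, |pdMulti α V x| ≤ (mIdx d q).card * K := by
      rw [← nsmul_eq_mul]
      refine Finset.sum_le_card_nsmul _ _ _ fun α hα => ?_
      rw [mem_mIdx] at hα
      exact h (.inr (.inr ()), α) (by simp [sw, wk, hα]; omega)
    simp only [mq]
    linarith

/-- the weight used -/
abbrev rr (A : Fin d → Rd d → ℝ) (U : Fin p → Rd d → ℝ) (V : Rd d → ℝ) (r N : ℕ) (μ : ℝ) :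
    Rd d → ℝ := rho (TT d p r) (ff A U V) sw N μ

/-- the normalised functions used -/
abbrev ph (A : Fin d → Rd d → ℝ) (U : Fin p → Rd d → ℝ) (V : Rd d → ℝ) (r N : ℕ) (μ : ℝ)
    (i : Kap d p × (Fin d → ℕ)) : Rd d → ℝ := phi (TT d p r) (ff A U V) sw N μ i

lemma deriv_bound (hS : Smooths A U V) {r N : ℕ} (hN : 2 ≤ N)
    (hs : ∀ i ∈ TT d p r, sw i ∣ N) {C₀ : ℝ} (hC₀ : 0 < C₀)
    (hT : ∀ x, mq A U V (r+1) x ≤ C₀ * mr A U V r x) :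
    ∃ M : ℝ, 1 ≤ M ∧ ∀ μ, 1 ≤ μ → ∀ j x, ∀ i ∈ TT d p r,
      |pdR j (ff A U V i) x| ≤ M * μ * rr A U V r N μ x ^ (sw i + 1) := by
  choose L hL0 hL using mq_le A U V
  have hsum : 0 ≤ ∑ q ∈ Finset.range (r+1), L q := Finset.sum_nonneg fun _ _ => hL0 _
  refine ⟨1 + C₀ * (1 + ∑ q ∈ Finset.range (r+1), L q), ?_, fun μ hμ j x i hi => ?_⟩
  · have : 0 ≤ C₀ * (1 + ∑ q ∈ Finset.range (r+1), L q) := by positivity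
    linarith
  have hμ0 : 0 < μ := by linarith
  set R := rr A U V r N μ x with hR
  have hR1 : 1 ≤ R := rho_ge_one x
  obtain ⟨k, α⟩ := i
  rw [ff_succ hS]
  have hi' := mem_TT.1 hi
  have hpos : 0 ≤ μ * R ^ (sw (k, α) + 1) := by positivity
  have hpos2 : 0 ≤ C₀ * (1 + ∑ q ∈ Finset.range (r+1), L q) := by positivity
  rcases Nat.lt_or_ge (sw (k, α)) (r + 1) with h | h
  · have h1 : (k, α + Pi.single j 1) ∈ TT d p r := mem_TT.2 (by rw [sw_succ]; omega)
    have h2 := f_le (f := ff A U V) hN hμ0 hs h1 x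
    rw [sw_succ] at h2
    refine h2.trans ?_
    change μ * R ^ (sw (k, α) + 1) ≤ _
    nlinarith
  · have h0 : sw (k, α) = r + 1 := by omega
    have h1 := (mq_ge (A := A) (U := U) (V := V) (q := r) (i := (k, α + Pi.single j 1))
      (by rw [sw_succ]; omega) x).trans (hT x)
    refine h1.trans ?_
    rw [h0] at hpos ⊢
    have h3 : mr A U V r x ≤ (1 + ∑ q ∈ Finset.range (r+1), L q) * (μ * R ^ (r + 1 + 1)) := by
      unfold mr
      rw [add_mul, one_mul, Finset.sum_mul]
      refine add_le_add ?_ (Finset.sum_le_sum fun q hq => ?_)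
      · exact one_le_mul_of_one_le_of_one_le hμ (one_le_pow₀ hR1)
      · refine hL q x _ fun i hiq => ?_
        rw [Finset.mem_range] at hq
        refine (f_le (f := ff A U V) hN hμ0 hs (mem_TT.2 (by omega : sw i ≤ r + 1)) x).trans ?_
        change μ * R ^ (sw i) ≤ _
        gcongr
        omega
    have := mul_le_mul_of_nonneg_left h3 hC₀.le
    nlinarith

end final

section final2
variable {d p : ℕ} {A : Fin d → Rd d → ℝ} {U : Fin p → Rd d → ℝ} {V : Rd d → ℝ}

lemma base_est (hS : Smooths A U V) {r N : ℕ} (hN : 2 ≤ N)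
    (hs : ∀ i ∈ TT d p r, sw i ∣ N) {M : ℝ} (hM1 : 1 ≤ M)
    (hM : ∀ μ, 1 ≤ μ → ∀ j x, ∀ i ∈ TT d p r,
      |pdR j (ff A U V i) x| ≤ M * μ * rr A U V r N μ x ^ (sw i + 1))
    {M₂ : ℝ} (hM2 : ∀ μ, 1 ≤ μ → ∀ j x, |pdR j (rr A U V r N μ) x| ≤ M₂ * rr A U V r N μ x ^ 2)
    (k : Kap d p) (hk : (k, (0 : Fin d → ℕ)) ∈ TT d p r) :
    ∃ K : ℝ, 0 ≤ K ∧ ∀ μ, 1 ≤ μ → ∀ u, Test u →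
      ∫ x, (rr A U V r N μ x ^ 4 * ph A U V r N μ (k, 0) x ^ 2) * ‖u x‖^2
        ≤ K / μ * EE A U V (rr A U V r N μ) u := by
  have hf : ∀ i ∈ TT d p r, ContDiff ℝ ∞ (ff A U V i) := fun i _ => ff_smooth hS i
  have hsm : ∀ μ, ContDiff ℝ ∞ (rr A U V r N μ) := fun μ => rho_smooth hf
  have hge : ∀ μ x, 1 ≤ rr A U V r N μ x := fun μ x => rho_ge_one x
  rcases k with l | jk | _
  · refine ⟨1 + 4 * d * M₂^2, by positivity, fun μ hμ u hu => ?_⟩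
    have hμ0 : 0 < μ := by linarith
    have hρc := (hsm μ).continuous
    have hUc : ∀ l, Continuous (U l) := fun l => (hS.hU l).continuous
    have h1 := energy hS hu (hsm μ) (hge μ) (hM2 μ hμ)
    have e : ∀ x, (rr A U V r N μ x ^ 4 * ph A U V r N μ (.inl l, 0) x ^ 2) * ‖u x‖^2
        = 1 / μ^2 * ((rr A U V r N μ x ^ 2 * U l x ^ 2) * ‖u x‖^2) := by
      intro x
      have := lt_of_lt_of_le one_pos (hge μ x)
      simp only [ph, phi, ff, pdMulti_zero, Fk, sw, wk]
      simp only [Pi.zero_apply, Finset.sum_const_zero, add_zero, pow_one]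
      field_simp
    simp_rw [e]
    rw [integral_const_mul]
    have h2 : ∫ x, (rr A U V r N μ x ^ 2 * U l x ^ 2) * ‖u x‖^2
        ≤ ∫ x, (rr A U V r N μ x ^ 2 * ∑ j, ‖Xop A j u x‖^2
          + (rr A U V r N μ x ^2 * ∑ l, U l x ^2) * ‖u x‖^2) := by
      refine integral_mono (int_mul_u hu (by fun_prop)) ?_ fun x => ?_
      · refine Integrable.add ?_ (int_mul_u hu (by fun_prop))
        exact int_mul_X hS hu (f := fun x => rr A U V r N μ x ^ 2) (by fun_prop)
      · have a1 : U l x ^ 2 ≤ ∑ l, U l x ^ 2 :=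
          Finset.single_le_sum (f := fun l => U l x ^ 2) (fun _ _ => sq_nonneg _) (Finset.mem_univ l)
        have a2 : 0 ≤ rr A U V r N μ x ^ 2 * ∑ j, ‖Xop A j u x‖^2 := by positivity
        have a3 : (rr A U V r N μ x ^ 2 * U l x ^ 2) * ‖u x‖^2
            ≤ (rr A U V r N μ x ^2 * ∑ l, U l x ^2) * ‖u x‖^2 := by gcongr
        simp only
        linarith
    have h3 : ∫ x, (‖Pop A U V u x‖^2 + ((1 + 4 * d * M₂^2) * rr A U V r N μ x ^ 4) * ‖u x‖^2)
        ≤ (1 + 4 * d * M₂^2) * EE A U V (rr A U V r N μ) u := by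
      unfold EE
      rw [← integral_const_mul]
      refine integral_mono ((int_P hS hu).add (int_mul_u hu (by fun_prop)))
        ((int_eden hS hu (hsm μ)).const_mul _) fun x => ?_
      simp only [eden]
      have a2 : 0 ≤ rr A U V r N μ x ^ 2 * ∑ j, ‖Xop A j u x‖^2 := by positivity
      have a3 : 0 ≤ 4 * d * M₂^2 := by positivity
      have a4 : 0 ≤ ‖Pop A U V u x‖^2 := by positivity
      nlinarith [mul_nonneg a3 a2, mul_nonneg a3 a4]
    have hE := EE_nonneg (A := A) (U := U) (V := V) (rr A U V r N μ) u
    calc 1 / μ^2 * ∫ x, (rr A U V r N μ x ^ 2 * U l x ^ 2) * ‖u x‖^2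
        ≤ 1 / μ * ((1 + 4 * d * M₂^2) * EE A U V (rr A U V r N μ) u) := by
          refine mul_le_mul ?_ (h2.trans (h1.trans h3)) ?_ (by positivity)
          · apply one_div_le_one_div_of_le hμ0; nlinarith
          · exact integral_nonneg fun x => by simp only [Pi.zero_apply]; positivity
      _ = _ := by ring
  · refine ⟨2 + 2 * M, by linarith, fun μ hμ u hu => ?_⟩
    have hμ0 : 0 < μ := by linarith
    have h1 := B_est hS hu (hsm μ) (hge μ) (M := M) (by linarith) hμ0.le jk.1.1 jk.1.2
      (fun x => by
        have := f_le (f := ff A U V) hN hμ0 hs hk x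
        simpa [ff, pdMulti_zero, Fk, sw, wk] using this)
      (fun i x => by
        have := hM μ hμ i x _ hk
        simpa [ff, pdMulti_zero, Fk, sw, wk] using this)
    have e : ∀ x, (rr A U V r N μ x ^ 4 * ph A U V r N μ (.inr (.inl jk), 0) x ^ 2) * ‖u x‖^2
        = 1 / μ^2 * (magB A jk.1.1 jk.1.2 x ^ 2 * ‖u x‖^2) := by
      intro x
      have := lt_of_lt_of_le one_pos (hge μ x)
      simp only [ph, phi, ff, pdMulti_zero, Fk, sw, wk]
      simp only [Pi.zero_apply, Finset.sum_const_zero, add_zero]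
      field_simp
    simp_rw [e]
    rw [integral_const_mul]
    calc _ ≤ 1 / μ^2 * (((2 + 2 * M) * μ) * EE A U V (rr A U V r N μ) u) := by gcongr
      _ = _ := by field_simp
  · refine ⟨1 + M * (1 + d), by positivity, fun μ hμ u hu => ?_⟩
    have hμ0 : 0 < μ := by linarith
    have h1 := V_est hS hu (hsm μ) (hge μ) (M := M) (by linarith) hμ0.le 
      (fun i x => by
        have := hM μ hμ i x _ hk
        simpa [ff, pdMulti_zero, Fk, sw, wk] using this)
    have e : ∀ x, (rr A U V r N μ x ^ 4 * ph A U V r N μ (.inr (.inr ()), 0) x ^ 2) * ‖u x‖^2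
        = 1 / μ^2 * (V x ^ 2 * ‖u x‖^2) := by
      intro x
      have := lt_of_lt_of_le one_pos (hge μ x)
      simp only [ph, phi, ff, pdMulti_zero, Fk, sw, wk]
      simp only [Pi.zero_apply, Finset.sum_const_zero, add_zero]
      field_simp
    simp_rw [e]
    rw [integral_const_mul]
    have hE := EE_nonneg (A := A) (U := U) (V := V) (rr A U V r N μ) u
    calc _ ≤ 1 / μ^2 * ((1 + M * μ * (1 + d)) * EE A U V (rr A U V r N μ) u) := by gcongr
      _ ≤ 1 / μ^2 * ((μ + M * μ * (1 + d)) * EE A U V (rr A U V r N μ) u) := by gcongr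
      _ = _ := by field_simp

lemma claim (hS : Smooths A U V) {r N : ℕ} (hN : 2 ≤ N)
    (hs : ∀ i ∈ TT d p r, sw i ∣ N) {M : ℝ} (hM1 : 1 ≤ M)
    (hM : ∀ μ, 1 ≤ μ → ∀ j x, ∀ i ∈ TT d p r,
      |pdR j (ff A U V i) x| ≤ M * μ * rr A U V r N μ x ^ (sw i + 1))
    {M₂ : ℝ} (hM20 : 0 ≤ M₂)
    (hM2 : ∀ μ, 1 ≤ μ → ∀ j x, |pdR j (rr A U V r N μ) x| ≤ M₂ * rr A U V r N μ x ^ 2)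
    (k : Kap d p) (n : ℕ) : ∀ α : Fin d → ℕ, ∑ j, α j = n → (k, α) ∈ TT d p r → ∀ ε : ℝ, 0 < ε →
    ∀ᶠ μ in atTop, ∀ u, Test u →
      ∫ x, (rr A U V r N μ x ^ 4 * ph A U V r N μ (k, α) x ^ 2) * ‖u x‖^2
        ≤ ε * EE A U V (rr A U V r N μ) u := by
  have hf : ∀ i ∈ TT d p r, ContDiff ℝ ∞ (ff A U V i) := fun i _ => ff_smooth hS i
  have hsm : ∀ μ, ContDiff ℝ ∞ (rr A U V r N μ) := fun μ => rho_smooth hf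
  have hge : ∀ μ x, 1 ≤ rr A U V r N μ x := fun μ x => rho_ge_one x
  induction n with
  | zero =>
    intro α hα hk ε hε
    have h0 : α = 0 := by
      funext j
      have := (Finset.sum_eq_zero_iff.1 hα) j (Finset.mem_univ j)
      simpa using this
    subst h0
    obtain ⟨K, hK0, hK⟩ := base_est hS hN hs hM1 hM hM2 k hk
    filter_upwards [eventually_ge_atTop (1:ℝ), eventually_ge_atTop (K / ε)] with μ hμ hμ2 u hu
    refine (hK μ hμ u hu).trans ?_
    refine mul_le_mul_of_nonneg_right ?_ (EE_nonneg _ u)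
    have hμ0 : 0 < μ := by linarith
    rw [div_le_iff₀ hε] at hμ2
    rw [div_le_iff₀ hμ0]
    linarith
  | succ n ih =>
    intro α hα hk ε hε
    obtain ⟨j, hj⟩ : ∃ j, α j ≠ 0 := by
      by_contra! h
      simp [h] at hα
    obtain ⟨β, rfl⟩ : ∃ β : Fin d → ℕ, α = β + Pi.single j 1 := by
      refine ⟨fun i => α i - (Pi.single j 1 : Fin d → ℕ) i, ?_⟩
      funext i
      by_cases hij : i = j
      · subst hij
        change α i = α i - (Pi.single i 1 : Fin d → ℕ) i + (Pi.single i 1 : Fin d → ℕ) i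
        rw [Pi.single_eq_same]
        omega
      · change α i = α i - (Pi.single j 1 : Fin d → ℕ) i + (Pi.single j 1 : Fin d → ℕ) i
        rw [Pi.single_eq_of_ne hij]
        omega
    have hsw := sw_succ k β j
    have hk' := mem_TT.1 hk
    have hβ : (k, β) ∈ TT d p r := mem_TT.2 (by omega)
    have hβn : ∑ j, β j = n := by
      simp only [Pi.add_apply, Finset.sum_add_distrib, Finset.sum_pi_single', Finset.mem_univ, if_true] at hα
      omega
    set M' : ℝ := M + (r + 1 : ℕ) * M₂ + M₂ with hM'
    have hrM : (0:ℝ) ≤ (r + 1 : ℕ) * M₂ := by positivity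
    have hM'1 : 1 ≤ M' := by linarith
    set K : ℝ := (5 * M'^2)^2 / (2 * (ε / 2)) with hK
    have hK0 : 0 ≤ K := by positivity
    have hε' : 0 < ε / (2 * (K + 1)) := by positivity
    filter_upwards [eventually_ge_atTop (1:ℝ), ih β hβn hβ _ hε'] with μ hμ hμ2 u hu
    have hμ0 : 0 < μ := by linarith
    have h1 := step_est hS hu (hsm μ) (phi_smooth (s := sw) (N := N) hμ0 hf hβ)
      (phi_smooth (s := sw) (N := N) hμ0 hf hk)
      (hge μ) hM'1 j
      (fun x => (hM2 μ hμ j x).trans (by gcongr; linarith))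
      (fun x => (phi_le hN hμ0 hs hk x).trans hM'1)
      (fun x => by
        have hx := hge μ x
        refine (phi_pd_le hN hμ0 hf hs j x (fun i hi => hM μ hμ j x i hi) (hM2 μ hμ j x) hk).trans ?_
        have : (sw (k, β + Pi.single j 1) : ℝ) * M₂ ≤ (r + 1 : ℕ) * M₂ := by gcongr
        gcongr
        linarith)
      (fun x => by
        have hx := hge μ x
        refine (phi_diff hμ0 hf j x (hM2 μ hμ j x) hβ (ff_succ hS k β j) hsw).trans ?_
        have : (sw (k, β) : ℝ) * M₂ ≤ (r + 1 : ℕ) * M₂ := by gcongr; omega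
        gcongr
        linarith)
      (half_pos hε)
    refine h1.trans ?_
    have h2 := hμ2 u hu
    have hE := EE_nonneg (A := A) (U := U) (V := V) (rr A U V r N μ) u
    have h3 := mul_le_mul_of_nonneg_left h2 hK0
    have h4 : K * (ε / (2 * (K + 1)) * EE A U V (rr A U V r N μ) u)
        ≤ ε / 2 * EE A U V (rr A U V r N μ) u := by
      rw [← mul_assoc]
      refine mul_le_mul_of_nonneg_right ?_ hE
      rw [mul_div_assoc', div_le_iff₀ (by positivity)]
      nlinarith
    change ε / 2 * EE A U V (rr A U V r N μ) u + K * _ ≤ _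
    linarith

end final2

section final3
variable {d p : ℕ} {A : Fin d → Rd d → ℝ} {U : Fin p → Rd d → ℝ} {V : Rd d → ℝ}

lemma EE_le (hS : Smooths A U V) {u : Rd d → ℂ} (hu : Test u) {ρ : Rd d → ℝ}
    (hρ : ContDiff ℝ ∞ ρ) (h1 : ∀ x, 1 ≤ ρ x) {M : ℝ}
    (hM : ∀ j x, |pdR j ρ x| ≤ M * ρ x ^ 2) :
    EE A U V ρ u ≤ 2 * (∫ x, ‖Pop A U V u x‖^2) + (2 + 4 * d * M^2) * ∫ x, ρ x ^ 4 * ‖u x‖^2 := by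
  have hUc : ∀ l, Continuous (U l) := fun l => (hS.hU l).continuous
  have hρc := hρ.continuous
  have h := energy hS hu hρ h1 hM
  have hX : Integrable (fun x => ρ x ^ 2 * ∑ j, ‖Xop A j u x‖^2) := by
    exact int_mul_X hS hu (f := fun x => ρ x ^ 2) (by fun_prop)
  have hU1 : Integrable (fun x => (ρ x ^2 * ∑ l, U l x ^2) * ‖u x‖^2) := int_mul_u hu (by fun_prop)
  have hu4 : Integrable (fun x => ρ x ^ 4 * ‖u x‖^2) := int_mul_u hu (by fun_prop)
  have hP := int_P hS hu
  have hnn : 0 ≤ ∫ x, (ρ x ^2 * ∑ l, U l x ^2) * ‖u x‖^2 :=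
    integral_nonneg fun x => by simp only [Pi.zero_apply]; positivity
  have e1 : ∀ x, ((1 + 4 * d * M^2) * ρ x ^ 4) * ‖u x‖^2
      = (1 + 4 * d * M^2) * (ρ x ^ 4 * ‖u x‖^2) := fun x => by ring
  simp_rw [e1] at h
  rw [integral_add hX hU1, integral_add hP (hu4.const_mul _), integral_const_mul] at h
  have e2 : EE A U V ρ u = (∫ x, ρ x ^ 4 * ‖u x‖^2) + (∫ x, ρ x ^ 2 * ∑ j, ‖Xop A j u x‖^2)
      + ∫ x, ‖Pop A U V u x‖^2 := by
    unfold EE eden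
    rw [← integral_add hu4 hX]
    exact integral_add (hu4.add hX) hP
  rw [e2]
  linarith

lemma W_le {r N : ℕ} (hr : 1 ≤ r) (hN : 2 ≤ N)
    (hs : ∀ i ∈ TT d p r, sw i ∣ N) {μ : ℝ} (hμ : 0 < μ) (x : Rd d) :
    ‖Wfun U V x‖^2 ≤ ((p * μ^2)^2 + μ^2) * rr A U V r N μ x ^ 4 := by
  set R := rr A U V r N μ x with hR
  have hU : ∀ l, |U l x| ≤ μ * R := fun l => by
    have := f_le (f := ff A U V) hN hμ hs (i := (.inl l, 0)) (mem_TT.2 (by simp [sw, wk])) x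
    simpa [ff, pdMulti_zero, Fk, sw, wk] using this
  have hV : |V x| ≤ μ * R ^ 2 := by
    have := f_le (f := ff A U V) hN hμ hs (i := (.inr (.inr ()), 0))
      (mem_TT.2 (by simp [sw, wk]; omega)) x
    simpa [ff, pdMulti_zero, Fk, sw, wk] using this
  have e : ‖Wfun U V x‖^2 = (∑ l, U l x ^ 2)^2 + V x ^ 2 := by
    rw [← Complex.normSq_eq_norm_sq]
    unfold Wfun
    rw [Complex.normSq_add_mul_I]
  have h1 : ∑ l, U l x ^ 2 ≤ p * (μ * R)^2 := by
    have := Finset.sum_le_card_nsmul (Finset.univ : Finset (Fin p)) (fun l => U l x ^ 2) ((μ * R)^2)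
      (fun l _ => by rw [← sq_abs]; exact pow_le_pow_left₀ (abs_nonneg _) (hU l) 2)
    simpa using this
  have h0 : 0 ≤ ∑ l, U l x ^ 2 := Finset.sum_nonneg fun _ _ => sq_nonneg _
  have h2 : V x ^ 2 ≤ (μ * R^2)^2 := by
    rw [← sq_abs]; exact pow_le_pow_left₀ (abs_nonneg _) hV 2
  have h3 := pow_le_pow_left₀ h0 h1 2
  rw [e]
  calc _ ≤ (p * (μ * R)^2)^2 + (μ * R^2)^2 := add_le_add h3 h2
    _ = _ := by ring

lemma main_est (hS : Smooths A U V) {r : ℕ} (hr : 1 ≤ r) {C₀ : ℝ} (hC₀ : 0 < C₀)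
    (hT : ∀ x, mq A U V (r+1) x ≤ C₀ * mr A U V r x) :
    ∃ C > 0, ∀ u : Rd d → ℂ, Test u →
      (∫ x : Rd d, ‖Wfun U V x‖^2 * ‖u x‖^2)
        ≤ C * ((∫ x : Rd d, ‖Pop A U V u x‖^2) + ∫ x : Rd d, ‖u x‖^2) := by
  set N := 2 * (r+1).factorial with hNdef
  have hN : 2 ≤ N := by have := Nat.factorial_pos (r+1); omega
  have hs : ∀ i ∈ TT d p r, sw i ∣ N := fun i hi =>
    Dvd.dvd.mul_left (Nat.dvd_factorial (sw_pos i) (mem_TT.1 hi)) 2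
  obtain ⟨M, hM1, hM⟩ := deriv_bound hS hN hs hC₀ hT
  have hf : ∀ i ∈ TT d p r, ContDiff ℝ ∞ (ff A U V i) := fun i _ => ff_smooth hS i
  set c : ℝ := ((TT d p r).card : ℝ) with hc
  have hc0 : 0 ≤ c := by positivity
  set M₂ : ℝ := c * M with hM₂
  have hM20 : 0 ≤ M₂ := by positivity
  have hM2 : ∀ μ, 1 ≤ μ → ∀ j x, |pdR j (rr A U V r N μ) x| ≤ M₂ * rr A U V r N μ x ^ 2 :=
    fun μ hμ j x => rho_grad hN (by linarith) hf hs j x (hM μ hμ j x)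
  set D : ℝ := 2 + 4 * d * M₂^2 with hD
  have hD2 : 2 ≤ D := by have : 0 ≤ 4 * d * M₂^2 := by positivity
                         linarith
  set ε : ℝ := 1 / (2 * (c + 1) * D) with hε
  have hε0 : 0 < ε := by positivity
  have hall : ∀ᶠ μ in atTop, ∀ i ∈ TT d p r, ∀ u, Test u →
      ∫ x, (rr A U V r N μ x ^ 4 * ph A U V r N μ i x ^ 2) * ‖u x‖^2
        ≤ ε * EE A U V (rr A U V r N μ) u := by
    rw [Filter.eventually_all_finset]
    rintro ⟨k, α⟩ hi
    exact claim hS hN hs hM1 hM hM20 hM2 k _ α rfl hi ε hε0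
  obtain ⟨μ, hμ, hμ1⟩ := (hall.and (eventually_ge_atTop (1:ℝ))).exists
  have hμ0 : 0 < μ := by linarith
  have hsm : ContDiff ℝ ∞ (rr A U V r N μ) := rho_smooth hf
  have hρc := hsm.continuous
  refine ⟨((p * μ^2)^2 + μ^2) * 2, by positivity, fun u hu => ?_⟩
  set S := ∫ x, rr A U V r N μ x ^ 4 * ‖u x‖^2 with hSdef
  set E := EE A U V (rr A U V r N μ) u with hE
  set a := ∫ x : Rd d, ‖Pop A U V u x‖^2
  set b := ∫ x : Rd d, ‖u x‖^2
  have ha : 0 ≤ a := integral_nonneg fun x => by simp only [Pi.zero_apply]; positivity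
  have hEnn : 0 ≤ E := EE_nonneg _ u
  have hu4 : Integrable (fun x => rr A U V r N μ x ^ 4 * ‖u x‖^2) := int_mul_u hu (by fun_prop)
  have hu0 : Integrable (fun x => ‖u x‖^2) := by
    simpa using int_mul_u hu (continuous_const (y := (1:ℝ)))
  have hph : ∀ i ∈ TT d p r,
      Integrable (fun x => (rr A U V r N μ x ^ 4 * ph A U V r N μ i x ^ 2) * ‖u x‖^2) := fun i hi => by
    have : Continuous (ph A U V r N μ i) := (phi_smooth (s := sw) (N := N) hμ0 hf hi).continuous
    exact int_mul_u hu (by fun_prop)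
  have k1 : S ≤ b + ∑ i ∈ TT d p r,
      ∫ x, (rr A U V r N μ x ^ 4 * ph A U V r N μ i x ^ 2) * ‖u x‖^2 := by
    rw [← integral_finsetSum _ hph, ← integral_add hu0 (integrable_finsetSum _ hph)]
    refine integral_mono hu4 (hu0.add (integrable_finsetSum _ hph)) fun x => ?_
    have := mul_le_mul_of_nonneg_right (rho_four (f := ff A U V) hN hμ0 hs x) (sq_nonneg ‖u x‖)
    rw [add_mul, one_mul, Finset.sum_mul] at this
    exact this
  have k2 : ∑ i ∈ TT d p r, ∫ x, (rr A U V r N μ x ^ 4 * ph A U V r N μ i x ^ 2) * ‖u x‖^2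
      ≤ c * (ε * E) := by
    have := Finset.sum_le_card_nsmul (TT d p r)
      (fun i => ∫ x, (rr A U V r N μ x ^ 4 * ph A U V r N μ i x ^ 2) * ‖u x‖^2) (ε * E)
      (fun i hi => hμ i hi u hu)
    rwa [nsmul_eq_mul] at this
  have k3 : E ≤ 2 * a + D * S := EE_le hS hu hsm (fun x => rho_ge_one x) (hM2 μ hμ1)
  have hSnn : 0 ≤ S := integral_nonneg fun x => by simp only [Pi.zero_apply]; positivity
  have k4 : c * ε * D ≤ 1 / 2 := by
    rw [hε]
    rw [mul_one_div, div_mul_eq_mul_div, div_le_iff₀ (by positivity)]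
    nlinarith
  have k5 : c * (ε * E) ≤ 1 / 2 * (a + S) := by
    have t1 : c * (ε * E) ≤ c * ε * (2 * a + D * S) := by rw [← mul_assoc]; gcongr
    have t2 : 2 * a + D * S ≤ D * (a + S) := by nlinarith
    calc _ ≤ c * ε * (D * (a + S)) := t1.trans (by gcongr)
      _ = c * ε * D * (a + S) := by ring
      _ ≤ _ := by gcongr
  have k6 : S ≤ 2 * (a + b) := by linarith
  have hUc : ∀ l, Continuous (U l) := fun l => (hS.hU l).continuous
  have hVc := hS.hV.continuous
  have k7 : ∫ x : Rd d, ‖Wfun U V x‖^2 * ‖u x‖^2 ≤ ((p * μ^2)^2 + μ^2) * S := by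
    rw [hSdef, ← integral_const_mul]
    refine integral_mono (int_mul_u hu (by unfold Wfun; fun_prop)) (hu4.const_mul _) fun x => ?_
    simp only
    rw [← mul_assoc]
    gcongr
    exact W_le hr hN hs hμ0 x
  refine k7.trans ?_
  rw [mul_assoc]
  gcongr

end final3

/-- if `(A,W) ∈ T(r,C₀)` then `‖ |W| u ‖² ≤ C (‖P_{A,W} u‖² + ‖u‖²)`
for all `u ∈ C_0^∞(ℝ^d;ℂ)`, where `|W| = (U² + V²)^{1/2}`. -/
theorem statement_0 (d p r : ℕ) (hd : 1 ≤ d) (hr : 1 ≤ r)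
    (A : Fin d → Rd d → ℝ) (U : Fin p → Rd d → ℝ) (V : Rd d → ℝ)
    (hA : ∀ j, ContDiff ℝ (⊤ : ℕ∞) (A j)) (hU : ∀ ℓ, ContDiff ℝ (⊤ : ℕ∞) (U ℓ)) (hV : ContDiff ℝ (⊤ : ℕ∞) V)
    (C₀ : ℝ) (hC₀ : 0 < C₀)
    (hT : ∀ x, mq A U V (r+1) x ≤ C₀ * mr A U V r x) :
    ∃ C > 0, ∀ u : Rd d → ℂ, ContDiff ℝ (⊤ : ℕ∞) u → HasCompactSupport u →
      (∫ x : Rd d, ‖Wfun U V x‖^2 * ‖u x‖^2)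
        ≤ C * ((∫ x : Rd d, ‖Pop A U V u x‖^2) + ∫ x : Rd d, ‖u x‖^2) := by
  obtain ⟨C, hC, h⟩ := main_est (A := A) (U := U) (V := V) ⟨hA, hU, hV⟩ hr hC₀ hT
  exact ⟨C, hC, fun u hu hc => h u ⟨hu, hc⟩⟩

end
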